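/- arXiv:2508.11308 — 6 statements merged into one kernel-verified Lean document; each statement's English description precedes it below -/
import Mathlib

section
/- Let m, n ≥ 2 and let D : Matrix (Fin m × Fin n) (Fin m × Fin n) ℂ be a diagonal matrix with real diagonal entries, exactly three of which equal 2 and all the others equal 1. Then for every unitary matrix U : Matrix (Fin m × Fin n) (Fin m × Fin n) ℂ, the partial transpose (U * D * Uᴴ)^Γ is positive semidefinite. (That is, D is absolutely PPT.) -/
open Matrix ComplexOrder

noncomputable section

/-- The product vector `a ⊗ b`. -/
def prodVec {m n : ℕ} (a : Fin m → ℂ) (b : Fin n → ℂ) : Fin m × Fin n → ℂ :=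
  fun p => a p.1 * b p.2

/-- `W` is block-positive: Hermitian, and the quadratic form on every product
vector is real and nonnegative. -/
def BlockPositive {m n : ℕ} (W : Matrix (Fin m × Fin n) (Fin m × Fin n) ℂ) : Prop :=
  W.IsHermitian ∧ ∀ (a : Fin m → ℂ) (b : Fin n → ℂ),
    0 ≤ (star (prodVec a b) ⬝ᵥ W.mulVec (prodVec a b)).re ∧
    (star (prodVec a b) ⬝ᵥ W.mulVec (prodVec a b)).im = 0

/-- Partial transpose: `M^Γ ((i,k),(j,l)) = M ((j,k),(i,l))`. -/
def ptrans {m n : ℕ} (M : Matrix (Fin m × Fin n) (Fin m × Fin n) ℂ) :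
    Matrix (Fin m × Fin n) (Fin m × Fin n) ℂ :=
  fun p q => M (q.1, p.2) (p.1, q.2)

/-- `W` is decomposable: `W = P + Q^Γ` with `P, Q` positive semidefinite. -/
def Decomposable {m n : ℕ} (W : Matrix (Fin m × Fin n) (Fin m × Fin n) ℂ) : Prop :=
  ∃ P Q : Matrix (Fin m × Fin n) (Fin m × Fin n) ℂ,
    P.PosSemidef ∧ Q.PosSemidef ∧ W = P + ptrans Q

/-- Negativity: absolute value of the sum of the negative eigenvalues. -/
noncomputable def negativity {N : Type*} [Fintype N] [DecidableEq N]
    {W : Matrix N N ℂ} (hW : W.IsHermitian) : ℝ :=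
  ∑ i, max (-(hW.eigenvalues i)) 0

/-- The eigenvalues of a Hermitian matrix, listed in non-increasing order with
multiplicity. -/
noncomputable def sortedEigs {N : Type*} [Fintype N] [DecidableEq N]
    {W : Matrix N N ℂ} (hW : W.IsHermitian) : List ℝ :=
  (Finset.univ.val.map hW.eigenvalues).sort (· ≥ ·)

theorem sumsq_eq {ι : Type*} [Fintype ι] (v : ι → ℂ) :
    v ⬝ᵥ star v = ((∑ i, ‖v i‖ ^ 2 : ℝ) : ℂ) := by
  simp [dotProduct, Complex.mul_conj, Complex.normSq_eq_norm_sq]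

theorem bessel {ι κ : Type*} [Fintype ι] [Fintype κ] [DecidableEq ι]
    (G : Matrix ι κ ℂ) (e : ι → ℝ) (he : ∀ i, e i ≤ 1)
    (hG : G * Gᴴ = diagonal (fun i => (e i : ℂ))) (v : κ → ℂ) :
    ∑ i, ‖(G *ᵥ v) i‖ ^ 2 ≤ ∑ k, ‖v k‖ ^ 2 := by
  set z := G *ᵥ v with hz
  have h1 : (v - Gᴴ *ᵥ z) ⬝ᵥ star (v - Gᴴ *ᵥ z)
      = v ⬝ᵥ star v - z ⬝ᵥ star z - z ⬝ᵥ star z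
        + (diagonal (fun i => (e i : ℂ)) *ᵥ z) ⬝ᵥ star z := by
    have hs : star (Gᴴ *ᵥ z) = star z ᵥ* G := by
      rw [star_mulVec, conjTranspose_conjTranspose]
    have a1 : v ⬝ᵥ (star z ᵥ* G) = z ⬝ᵥ star z := by
      rw [dotProduct_comm, ← dotProduct_mulVec, dotProduct_comm]
    have a2 : (Gᴴ *ᵥ z) ⬝ᵥ star v = z ⬝ᵥ star z := by
      rw [dotProduct_comm, dotProduct_mulVec, ← star_mulVec, dotProduct_comm]
    have a3 : (Gᴴ *ᵥ z) ⬝ᵥ (star z ᵥ* G)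
        = (diagonal (fun i => (e i : ℂ)) *ᵥ z) ⬝ᵥ star z := by
      rw [dotProduct_comm, ← dotProduct_mulVec, mulVec_mulVec, hG, dotProduct_comm]
    rw [star_sub, sub_dotProduct, dotProduct_sub, dotProduct_sub, hs, a1, a2, a3]
    ring
  have h2 : (diagonal (fun i => (e i : ℂ)) *ᵥ z) ⬝ᵥ star z
      = ((∑ i, e i * ‖z i‖ ^ 2 : ℝ) : ℂ) := by
    simp only [dotProduct, mulVec_diagonal, Pi.star_apply, mul_assoc, RCLike.star_def,
      Complex.mul_conj, Complex.normSq_eq_norm_sq]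
    push_cast
    rfl
  rw [sumsq_eq, sumsq_eq, sumsq_eq, h2] at h1
  have h3 : ∑ i, e i * ‖z i‖ ^ 2 ≤ ∑ i, ‖z i‖ ^ 2 := by
    refine Finset.sum_le_sum fun i _ => ?_
    nlinarith [he i, sq_nonneg ‖z i‖]
  have h4 : 0 ≤ ∑ i, ‖(v - Gᴴ *ᵥ z) i‖ ^ 2 := by positivity
  have h5 := congrArg Complex.re h1
  simp only [Complex.ofReal_re, Complex.add_re, Complex.sub_re] at h5
  linarith

theorem graph_ineq {ι : Type*} [Fintype ι] [DecidableEq ι] (w : ι → ι → ℝ) (s : ι → ℝ)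
    (hs : ∀ i, 0 ≤ s i) (hw0 : ∀ i j, 0 ≤ w i j) (hw1 : ∀ i j, w i j ≤ 1)
    (hsym : ∀ i j, w i j = w j i) (hd : ∀ i, w i i = 0) (hsum : ∑ i, ∑ j, w i j ≤ 6) :
    ∑ i, ∑ j, w i j * (s i * s j) ≤ 2 * ∑ i, s i ^ 2 := by
  set d : ι → ℝ := fun i => ∑ j, w i j with hdd
  have hle : ∀ i j, w i j ≤ d i := fun i j =>
    Finset.single_le_sum (f := fun j => w i j) (fun j _ => hw0 i j) (Finset.mem_univ j)
  have hd0 : ∀ i, 0 ≤ d i := fun i => Finset.sum_nonneg fun j _ => hw0 i j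
  have hdij : ∀ i j, i ≠ j → d i + d j ≤ 4 := by
    intro i j hij
    -- total = d i + d j + rest, rest at least d i + d j - 2 w i j
    have e1 : ∑ k, d k = d i + d j + ∑ k ∈ (Finset.univ \ {i, j}), d k := by
      rw [← Finset.sum_sdiff (Finset.subset_univ {i, j}), Finset.sum_pair hij]; ring
    have e2 : ∑ k ∈ (Finset.univ \ {i, j}), (w k i + w k j)
        ≤ ∑ k ∈ (Finset.univ \ {i, j}), d k := by
      refine Finset.sum_le_sum fun k _ => ?_
      rw [← Finset.sum_pair hij]
      exact Finset.sum_le_sum_of_subset_of_nonneg (Finset.subset_univ _) fun j _ _ => hw0 k j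
    have e3 : d i + d j = 2 * w i j + ∑ k ∈ (Finset.univ \ {i, j}), (w k i + w k j) := by
      simp only [hdd]
      rw [← Finset.sum_add_distrib, ← Finset.sum_sdiff (Finset.subset_univ {i, j}),
        Finset.sum_pair hij, hd, hd, hsym j i]
      have hc : ∑ k ∈ (Finset.univ \ {i, j}), (w i k + w j k)
          = ∑ k ∈ (Finset.univ \ {i, j}), (w k i + w k j) :=
        Finset.sum_congr rfl fun k _ => by rw [hsym i k, hsym j k]
      rw [hc]
      ring
    have := hw1 i j
    have h6 : ∑ k, d k ≤ 6 := hsum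
    linarith
  have key : ∀ i j, w i j * (s i * s j) ≤ w i j * (s i ^ 2 / d i) + w i j * (s j ^ 2 / d j) := by
    intro i j
    rcases (hw0 i j).eq_or_lt with h0 | hpos
    · rw [← h0]; simp
    have hij : i ≠ j := by
      rintro rfl
      rw [hd] at hpos
      exact lt_irrefl _ hpos
    have hi : 0 < d i := lt_of_lt_of_le hpos (hle i j)
    have hj : 0 < d j := lt_of_lt_of_le hpos (by rw [hsym]; exact hle j i)
    rw [← mul_add]
    refine mul_le_mul_of_nonneg_left ?_ hpos.le
    rw [div_add_div _ _ hi.ne' hj.ne', le_div_iff₀ (by positivity)]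
    have h4 := hdij i j hij
    have hij0 : 0 ≤ s i * s j := mul_nonneg (hs i) (hs j)
    have hsq : 0 ≤ (d i * d j) * (4 - d i * d j) := by
      have : d i * d j ≤ 4 := by nlinarith [sq_nonneg (d i - d j)]
      have : 0 ≤ d i * d j := by positivity
      apply mul_nonneg <;> linarith
    have hA : 0 ≤ s i ^ 2 * d j + d i * s j ^ 2 := by positivity
    refine abs_le_of_sq_le_sq' ?_ hA |>.2
    nlinarith [sq_nonneg (s i ^ 2 * d j - d i * s j ^ 2),
      mul_nonneg hsq (sq_nonneg (s i * s j))]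
  have hb : ∀ i, d i * (s i ^ 2 / d i) ≤ s i ^ 2 := by
    intro i
    rcases (hd0 i).eq_or_lt with h0 | hpos
    · rw [← h0]; simp; positivity
    · rw [mul_div_cancel₀ _ hpos.ne']
  have t1 : ∑ i, ∑ j, w i j * (s i ^ 2 / d i) ≤ ∑ i, s i ^ 2 := by
    refine Finset.sum_le_sum fun i _ => ?_
    rw [← Finset.sum_mul]
    exact hb i
  have t2 : ∑ i, ∑ j, w i j * (s j ^ 2 / d j) ≤ ∑ i, s i ^ 2 := by
    rw [Finset.sum_comm]
    refine le_trans (le_of_eq ?_) t1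
    refine Finset.sum_congr rfl fun i _ => Finset.sum_congr rfl fun j _ => ?_
    rw [hsym]
  calc _ ≤ ∑ i, ∑ j, (w i j * (s i ^ 2 / d i) + w i j * (s j ^ 2 / d j)) :=
        Finset.sum_le_sum fun i _ => Finset.sum_le_sum fun j _ => key i j
    _ ≤ _ := by
        simp only [Finset.sum_add_distrib]
        linarith

theorem svd_like {m n : ℕ} (X : Matrix (Fin m) (Fin n) ℂ) :
    ∃ (R : Matrix (Fin m) (Fin m) ℂ) (F : Matrix (Fin m) (Fin n) ℂ) (s e : Fin m → ℝ),
      R * Rᴴ = 1 ∧ Rᴴ * R = 1 ∧ (∀ i, 0 ≤ s i) ∧ (∀ i, e i ≤ 1) ∧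
      F * Fᴴ = diagonal (fun i => (e i : ℂ)) ∧
      R * X = diagonal (fun i => (s i : ℂ)) * F ∧
      ∑ i, s i ^ 2 = ∑ i, ∑ k, ‖X i k‖ ^ 2 := by
  have hps : (X * Xᴴ).PosSemidef := posSemidef_self_mul_conjTranspose X
  have hH := hps.isHermitian
  set Q : Matrix (Fin m) (Fin m) ℂ := (hH.eigenvectorUnitary : Matrix (Fin m) (Fin m) ℂ) with hQ
  have hQ1 : Qᴴ * Q = 1 := by
    have := Unitary.coe_star_mul_self hH.eigenvectorUnitary
    simpa [star_eq_conjTranspose] using this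
  have hQ2 : Q * Qᴴ = 1 := by
    have := Unitary.coe_mul_star_self hH.eigenvectorUnitary
    simpa [star_eq_conjTranspose] using this
  set l := hH.eigenvalues with hl
  have hl0 : ∀ i, 0 ≤ l i := hps.eigenvalues_nonneg
  have hspec : X * Xᴴ = Q * diagonal (fun i => (l i : ℂ)) * Qᴴ := by
    have := hH.spectral_theorem
    rw [Unitary.conjStarAlgAut_apply] at this
    exact this
  set B := Qᴴ * X with hB
  have hBB : B * Bᴴ = diagonal (fun i => (l i : ℂ)) := by
    rw [hB, conjTranspose_mul, conjTranspose_conjTranspose]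
    calc Qᴴ * X * (Xᴴ * Q) = Qᴴ * (X * Xᴴ) * Q := by simp only [Matrix.mul_assoc]
      _ = (Qᴴ * Q) * diagonal (fun i => (l i : ℂ)) * (Qᴴ * Q) := by
        rw [hspec]; simp only [Matrix.mul_assoc]
      _ = _ := by rw [hQ1]; simp
  have hBz : ∀ i, l i = 0 → ∀ k, B i k = 0 := by
    intro i hi k
    have h := congrFun (congrFun hBB i) i
    have h' : (fun k => B i k) ⬝ᵥ star (fun k => B i k) = 0 := by
      rw [diagonal_apply_eq, hi, Matrix.mul_apply] at h
      rw [dotProduct]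
      refine Eq.trans ?_ (h.trans Complex.ofReal_zero)
      rfl
    rw [sumsq_eq] at h'
    have h2 : ∑ k, ‖B i k‖ ^ 2 = 0 := by exact_mod_cast h'
    rw [Finset.sum_eq_zero_iff_of_nonneg (fun k _ => by positivity)] at h2
    simpa using h2 k (Finset.mem_univ k)
  refine ⟨Qᴴ, diagonal (fun i => ((Real.sqrt (l i))⁻¹ : ℂ)) * B, fun i => Real.sqrt (l i),
    fun i => if l i = 0 then 0 else 1, by simpa using hQ1, by simpa using hQ2,
    fun i => Real.sqrt_nonneg _, ?_, ?_, ?_, ?_⟩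
  · intro i
    dsimp only
    split_ifs <;> norm_num
  · rw [conjTranspose_mul, diagonal_conjTranspose]
    rw [Matrix.mul_assoc, ← Matrix.mul_assoc B, hBB, diagonal_mul_diagonal, diagonal_mul_diagonal]
    congr 1
    funext i
    by_cases h : l i = 0
    · simp [h]
    · have hp : 0 < l i := lt_of_le_of_ne (hl0 i) (Ne.symm h)
      have hsq : Real.sqrt (l i) ≠ 0 := (Real.sqrt_pos.2 hp).ne'
      simp only [h, if_false, Pi.star_apply, star_inv₀, RCLike.star_def, Complex.conj_ofReal]
      norm_cast
      have := Real.mul_self_sqrt (hl0 i)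
      field_simp
      nlinarith
  · rw [← Matrix.mul_assoc, diagonal_mul_diagonal]
    ext i k
    rw [diagonal_mul]
    change B i k = _
    by_cases h : l i = 0
    · rw [hBz i h k, mul_zero]
    · have hp : 0 < l i := lt_of_le_of_ne (hl0 i) (Ne.symm h)
      have hsq : (Real.sqrt (l i) : ℂ) ≠ 0 := by exact_mod_cast (Real.sqrt_pos.2 hp).ne'
      rw [mul_inv_cancel₀ hsq, one_mul]
  · have h1 : (X * Xᴴ).trace = ((∑ i, l i : ℝ) : ℂ) := by
      rw [hH.trace_eq_sum_eigenvalues]; push_cast; rfl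
    have h2 : (X * Xᴴ).trace = ((∑ i, ∑ k, ‖X i k‖ ^ 2 : ℝ) : ℂ) := by
      simp [trace, Matrix.mul_apply, Complex.mul_conj, Complex.normSq_eq_norm_sq]
    have h3 : ∑ i, l i = ∑ i, ∑ k, ‖X i k‖ ^ 2 := by
      rw [h1] at h2; exact_mod_cast h2
    rw [← h3]
    exact Finset.sum_congr rfl fun i _ => Real.sq_sqrt (hl0 i)

/-- Core bound. -/
theorem core {m n : ℕ} (X : Matrix (Fin m) (Fin n) ℂ)
    (S : Finset (Fin m × Fin n)) (hS : S.card = 3)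
    (U : Matrix (Fin m × Fin n) (Fin m × Fin n) ℂ)
    (hU₂ : Uᴴ * U = 1) (Z : Fin m × Fin n → Matrix (Fin m) (Fin m) ℂ)
    (hZ : ∀ p, Z p = X * (Matrix.of fun i k => U (i, k) p)ᵀ) :
    -(∑ i, ∑ k, ‖X i k‖ ^ 2) ≤ (∑ p ∈ S, (Z p * (Z p).map star).trace).re := by
  obtain ⟨R, F, s, e, hR1, hR2, hs, he, hF, hRX, hsum⟩ := svd_like X
  set G : Matrix (Fin m × Fin m) (Fin m × Fin n) ℂ := kroneckerMap (· * ·) R F with hG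
  have hGG : G * Gᴴ = diagonal (fun q : Fin m × Fin m => (e q.2 : ℂ)) := by
    rw [hG, conjTranspose_kronecker, ← mul_kronecker_mul, hR1, hF, ← diagonal_one,
      diagonal_kronecker_diagonal]
    simp
  set Y : Fin m × Fin n → Matrix (Fin m) (Fin m) ℂ :=
    fun p => F * (Matrix.of fun i k => U (i, k) p)ᵀ * Rᵀ with hY
  have hYG : ∀ p i j, Y p i j = (G *ᵥ (fun q => U q p)) (j, i) := by
    intro p i j
    simp only [hY, hG, Matrix.mul_apply, mulVec, dotProduct, transpose_apply, of_apply,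
      kroneckerMap_apply, Fintype.sum_prod_type, Finset.sum_mul]
    refine Finset.sum_congr rfl fun a _ => Finset.sum_congr rfl fun k _ => ?_
    ring
  have htr : ∀ p, (Z p * (Z p).map star).trace
      = ∑ i, ∑ j, ((s i * s j : ℝ) : ℂ) * (Y p i j * star (Y p j i)) := by
    intro p
    have e1 : R * Z p * Rᵀ = diagonal (fun i => (s i : ℂ)) * Y p := by
      rw [hZ, ← Matrix.mul_assoc, hRX]
      simp only [hY, Matrix.mul_assoc]
    have e2 : (R * Z p * Rᵀ).map star = R.map star * (Z p).map star * Rᴴ := by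
      ext i j
      simp [Matrix.mul_apply, Matrix.map_apply]
    have e3 : Rᵀ * R.map star = 1 := by
      have := congrArg transpose hR2
      rw [transpose_mul, transpose_one] at this
      exact this
    have e4 : (R * Z p * Rᵀ * (R * Z p * Rᵀ).map star).trace
        = (Z p * (Z p).map star).trace := by
      rw [e2]
      calc _ = (R * (Z p * ((Rᵀ * R.map star) * (Z p).map star) * Rᴴ)).trace := by
            simp only [Matrix.mul_assoc]
        _ = _ := by
            rw [e3, Matrix.one_mul, Matrix.trace_mul_comm, Matrix.mul_assoc, hR2, Matrix.mul_one]
    rw [← e4, e1]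
    simp only [trace, diag_apply]
    refine Finset.sum_congr rfl fun i _ => ?_
    rw [Matrix.mul_apply]
    refine Finset.sum_congr rfl fun j _ => ?_
    rw [Matrix.map_apply, diagonal_mul, diagonal_mul]
    simp only [star_mul', RCLike.star_def, Complex.conj_ofReal, Complex.ofReal_mul]
    ring
  set w : Fin m → Fin m → ℝ := fun i j => ∑ p ∈ S, ‖Y p i j - Y p j i‖ ^ 2 / 2 with hw
  have hw0 : ∀ i j, 0 ≤ w i j := fun i j => Finset.sum_nonneg fun p _ => by positivity
  have hwd : ∀ i, w i i = 0 := fun i => by simp [hw]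
  have hwsym : ∀ i j, w i j = w j i := fun i j => by simp only [hw, norm_sub_rev]
  have hw1 : ∀ i j, w i j ≤ 1 := by
    intro i j
    by_cases hij : i = j
    · rw [hij, hwd]; norm_num
    set r : Fin m × Fin n → ℂ := fun q => G (j, i) q - G (i, j) q with hr
    have hUT : Uᵀ * Uᵀᴴ = diagonal (fun _ => ((1 : ℝ) : ℂ)) := by
      have := congrArg transpose hU₂
      rw [transpose_mul, transpose_one] at this
      rw [show Uᵀᴴ = Uᴴᵀ from rfl, this]
      simp
    have hb := bessel Uᵀ (fun _ => 1) (fun _ => le_rfl) hUT r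
    have hyr : ∀ p, (Uᵀ *ᵥ r) p = Y p i j - Y p j i := by
      intro p
      rw [hYG, hYG]
      simp only [mulVec, dotProduct, transpose_apply, hr, ← Finset.sum_sub_distrib]
      refine Finset.sum_congr rfl fun q _ => ?_
      ring
    have hrn : ∑ q, ‖r q‖ ^ 2 = e i + e j := by
      have h1 := sumsq_eq r
      have h2 : r ⬝ᵥ star r = (G * Gᴴ) (j, i) (j, i) - (G * Gᴴ) (j, i) (i, j)
          - (G * Gᴴ) (i, j) (j, i) + (G * Gᴴ) (i, j) (i, j) := by
        simp only [Matrix.mul_apply, dotProduct, ← Finset.sum_sub_distrib,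
          ← Finset.sum_add_distrib]
        refine Finset.sum_congr rfl fun q _ => ?_
        simp [hr]
        ring
      rw [h1, hGG, diagonal_apply_eq, diagonal_apply_eq, diagonal_apply_ne, diagonal_apply_ne] at h2
      · simp only [sub_zero] at h2
        exact_mod_cast h2
      · simp [hij]
      · simp [Ne.symm hij, hij]
    have hsub : ∑ p ∈ S, ‖Y p i j - Y p j i‖ ^ 2 ≤ ∑ p, ‖(Uᵀ *ᵥ r) p‖ ^ 2 := by
      simp only [hyr]
      exact Finset.sum_le_sum_of_subset_of_nonneg (Finset.subset_univ _)
        fun p _ _ => by positivity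
    simp only [hw]
    rw [← Finset.sum_div]
    have := he i
    have := he j
    linarith
  have hYn : ∀ p, ∑ i, ∑ j, ‖Y p i j‖ ^ 2 ≤ 1 := by
    intro p
    have hb := bessel G _ (fun q => he q.2) hGG (fun q => U q p)
    have h1 : ∑ q, ‖U q p‖ ^ 2 = 1 := by
      have h1 := sumsq_eq (fun q => U q p)
      have h2 := congrFun (congrFun hU₂ p) p
      rw [one_apply_eq] at h2
      have h3 : (fun q => U q p) ⬝ᵥ star (fun q => U q p) = 1 := by
        rw [← h2, Matrix.mul_apply, dotProduct]
        refine Finset.sum_congr rfl fun q _ => ?_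
        simp [mul_comm]
      rw [h1] at h3
      exact_mod_cast h3
    rw [h1, Fintype.sum_prod_type, Finset.sum_comm] at hb
    simpa only [hYG] using hb
  have hwsum : ∑ i, ∑ j, w i j ≤ 6 := by
    have hpw : ∀ p, ∑ i, ∑ j, ‖Y p i j - Y p j i‖ ^ 2 / 2 ≤ 2 := by
      intro p
      have h1 := hYn p
      have h2 : ∑ i, ∑ j, ‖Y p j i‖ ^ 2 ≤ 1 := by rw [Finset.sum_comm]; exact h1
      have h3 : ∑ i, ∑ j, ‖Y p i j - Y p j i‖ ^ 2 / 2
          ≤ ∑ i, ∑ j, (‖Y p i j‖ ^ 2 + ‖Y p j i‖ ^ 2) := by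
        refine Finset.sum_le_sum fun i _ => Finset.sum_le_sum fun j _ => ?_
        have := norm_sub_le (Y p i j) (Y p j i)
        nlinarith [sq_nonneg (‖Y p i j‖ - ‖Y p j i‖), norm_nonneg (Y p i j - Y p j i),
          norm_nonneg (Y p i j), norm_nonneg (Y p j i)]
      simp only [Finset.sum_add_distrib] at h3
      linarith
    have h1 : ∑ i, ∑ j, w i j = ∑ p ∈ S, ∑ i, ∑ j, ‖Y p i j - Y p j i‖ ^ 2 / 2 := by
      simp only [hw]
      rw [Finset.sum_comm' (s := S) (t := fun _ => Finset.univ) (t' := Finset.univ)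
        (s' := fun _ => S) (by simp)]
      refine Finset.sum_congr rfl fun i _ => ?_
      rw [Finset.sum_comm]
    rw [h1]
    calc _ ≤ ∑ p ∈ S, (2 : ℝ) := Finset.sum_le_sum fun p _ => hpw p
      _ = 6 := by rw [Finset.sum_const, hS]; norm_num
  have hg := graph_ineq w s hs hw0 hw1 hwsym hwd hwsum
  have hre : -(1 / 2) * ∑ i, ∑ j, w i j * (s i * s j)
      ≤ (∑ p ∈ S, (Z p * (Z p).map star).trace).re := by
    have h1 : ∑ i, ∑ j, w i j * (s i * s j)
        = ∑ p ∈ S, ∑ i, ∑ j, (s i * s j) * (‖Y p i j - Y p j i‖ ^ 2 / 2) := by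
      simp only [hw]
      rw [Finset.sum_comm' (s := S) (t := fun _ => Finset.univ) (t' := Finset.univ)
        (s' := fun _ => S) (by simp)]
      refine Finset.sum_congr rfl fun i _ => ?_
      rw [Finset.sum_comm]
      refine Finset.sum_congr rfl fun j _ => ?_
      rw [Finset.sum_mul]
      exact Finset.sum_congr rfl fun p _ => mul_comm _ _
    rw [h1, Complex.re_sum, Finset.mul_sum]
    refine Finset.sum_le_sum fun p _ => ?_
    rw [htr, Complex.re_sum, Finset.mul_sum]
    refine Finset.sum_le_sum fun i _ => ?_
    rw [Complex.re_sum, Finset.mul_sum]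
    refine Finset.sum_le_sum fun j _ => ?_
    rw [Complex.re_ofReal_mul]
    have hss : 0 ≤ s i * s j := mul_nonneg (hs i) (hs j)
    have : -(1 / 4) * ‖Y p i j - Y p j i‖ ^ 2 ≤ (Y p i j * star (Y p j i)).re := by
      rw [← Complex.normSq_eq_norm_sq, Complex.normSq_apply]
      simp only [Complex.mul_re, RCLike.star_def, Complex.conj_re, Complex.conj_im,
        Complex.sub_re, Complex.sub_im]
      nlinarith [sq_nonneg ((Y p i j).re + (Y p j i).re), sq_nonneg ((Y p i j).im + (Y p j i).im)]
    nlinarith [mul_le_mul_of_nonneg_left this hss]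
  rw [← hsum]
  linarith

/-- A diagonal matrix with exactly three diagonal entries equal to `2` and all
others equal to `1` is absolutely PPT. -/
theorem stmt_3 {m n : ℕ} (hm : 2 ≤ m) (hn : 2 ≤ n)
    (D : Matrix (Fin m × Fin n) (Fin m × Fin n) ℂ)
    (hdiag : ∀ p q, p ≠ q → D p q = 0)
    (S : Finset (Fin m × Fin n)) (hS : S.card = 3)
    (hin : ∀ p ∈ S, D p p = 2)
    (hout : ∀ p ∉ S, D p p = 1)
    (U : Matrix (Fin m × Fin n) (Fin m × Fin n) ℂ)
    (hU₁ : U * Uᴴ = 1) (hU₂ : Uᴴ * U = 1) :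
    (ptrans (U * D * Uᴴ)).PosSemidef := by
  have hDd : D = diagonal (fun p => D p p) := by
    ext p q
    by_cases h : p = q
    · subst h; simp
    · rw [diagonal_apply_ne _ h, hdiag p q h]
  have hDst : Dᴴ = D := by
    rw [hDd, diagonal_conjTranspose]
    congr 1
    funext p
    by_cases h : p ∈ S
    · simp [hin p h]
    · simp [hout p h]
  have hMH : (U * D * Uᴴ).IsHermitian := by
    rw [IsHermitian, conjTranspose_mul, conjTranspose_mul, conjTranspose_conjTranspose, hDst,
      Matrix.mul_assoc]
  have hH : (ptrans (U * D * Uᴴ)).IsHermitian := by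
    ext p q
    exact hMH.apply _ _
  refine PosSemidef.of_dotProduct_mulVec_nonneg hH fun x => ?_
  have him : (star x ⬝ᵥ (ptrans (U * D * Uᴴ) *ᵥ x)).im = 0 :=
    hH.im_star_dotProduct_mulVec_self x
  have hent : ∀ q r, (U * D * Uᴴ) q r = (if q = r then 1 else 0)
      + ∑ p ∈ S, U q p * star (U r p) := by
    intro q r
    have h1 : (if q = r then (1 : ℂ) else 0) = ∑ p, U q p * star (U r p) := by
      rw [← Matrix.one_apply, ← hU₁, Matrix.mul_apply]
      rfl
    have h2 : ∑ p ∈ S, U q p * star (U r p)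
        = ∑ p, if p ∈ S then U q p * star (U r p) else 0 := by
      rw [Finset.sum_ite_mem, Finset.univ_inter]
    rw [h1, h2, ← Finset.sum_add_distrib, hDd, Matrix.mul_apply]
    refine Finset.sum_congr rfl fun p _ => ?_
    rw [mul_diagonal, conjTranspose_apply]
    by_cases h : p ∈ S
    · rw [hin p h, if_pos h]; ring
    · rw [hout p h, if_neg h]; ring
  set X : Matrix (Fin m) (Fin n) ℂ := Matrix.of fun i k => star (x (i, k)) with hX
  set Z : Fin m × Fin n → Matrix (Fin m) (Fin m) ℂ :=
    fun p => X * (Matrix.of fun i k => U (i, k) p)ᵀ with hZ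
  have hc := core X S hS U hU₂ Z (fun p => rfl)
  have hmain : star x ⬝ᵥ (ptrans (U * D * Uᴴ) *ᵥ x)
      = ((∑ i, ∑ k, ‖X i k‖ ^ 2 : ℝ) : ℂ) + ∑ p ∈ S, (Z p * (Z p).map star).trace := by
    set N : Fin m × Fin n → Matrix (Fin m × Fin n) (Fin m × Fin n) ℂ :=
      fun p => Matrix.of fun q r => U (r.1, q.2) p * star (U (q.1, r.2) p) with hN
    have hpt : ptrans (U * D * Uᴴ) = 1 + ∑ p ∈ S, N p := by
      ext q r
      rw [Matrix.add_apply, Matrix.sum_apply, Matrix.one_apply]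
      change (U * D * Uᴴ) (r.1, q.2) (q.1, r.2) = _
      rw [hent]
      congr 1
      refine if_congr ?_ rfl rfl
      rw [Prod.mk.injEq, Prod.ext_iff]
      exact ⟨fun h => ⟨h.1.symm, h.2⟩, fun h => ⟨h.1.symm, h.2⟩⟩
    rw [hpt, add_mulVec, one_mulVec, dotProduct_add, sum_mulVec, dotProduct_sum]
    congr 1
    · rw [dotProduct_comm, sumsq_eq, Fintype.sum_prod_type]
      simp [hX]
    · refine Finset.sum_congr rfl fun p _ => ?_
      simp only [trace, diag_apply, hZ, hX, hN, Matrix.mul_apply, Matrix.map_apply, mulVec,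
        dotProduct, of_apply, transpose_apply, Fintype.sum_prod_type, star_sum, star_mul',
        star_star, Pi.star_apply, Finset.sum_mul, Finset.mul_sum]
      refine Finset.sum_congr rfl fun i _ => ?_
      rw [Finset.sum_comm]
      refine Finset.sum_congr rfl fun j _ => ?_
      rw [Finset.sum_comm]
      refine Finset.sum_congr rfl fun k _ =>
        Finset.sum_congr rfl fun l _ => ?_
      ring
  rw [Complex.nonneg_iff]
  refine ⟨?_, him.symm⟩
  rw [hmain, Complex.add_re, Complex.ofReal_re]
  linarith

end
end

section
/- Let m, n ≥ 2 and let W be a normalized m×n entanglement witness. Then the trace of W² (a real number since W is Hermitian) satisfies 1/(m*n − 1) < tr(W²) ≤ 1. -/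
open Matrix ComplexOrder

noncomputable section

theorem aux_trace_sq {N : Type*} [Fintype N] [DecidableEq N] {A : Matrix N N ℂ}
    (hA : A.IsHermitian) : ((A * A).trace).re = ∑ i, (hA.eigenvalues i) ^ 2 := by
  have h : (A * A).trace = ∑ i, ((hA.eigenvalues i : ℂ)) ^ 2 := by
    conv_lhs => rw [hA.spectral_theorem, ← map_mul, Unitary.conjStarAlgAut_apply,
      Matrix.trace_mul_cycle, Unitary.coe_star_mul_self, one_mul, Matrix.diagonal_mul_diagonal,
      Matrix.trace_diagonal]
    simp [pow_two]
  rw [h]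
  norm_cast

theorem aux_trace {N : Type*} [Fintype N] [DecidableEq N] {A : Matrix N N ℂ}
    (hA : A.IsHermitian) : A.trace = ((∑ i, hA.eigenvalues i : ℝ) : ℂ) := by
  rw [hA.trace_eq_sum_eigenvalues]
  push_cast
  rfl

/-- For PSD matrices, `tr X² ≤ (tr X)²`. -/
theorem aux_psd {N : Type*} [Fintype N] [DecidableEq N] {A : Matrix N N ℂ}
    (hA : A.PosSemidef) : 0 ≤ (A.trace * A.trace - (A * A).trace).re := by
  have h := hA.isHermitian
  rw [Complex.sub_re, aux_trace_sq h, aux_trace h, ← Complex.ofReal_mul, Complex.ofReal_re,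
    sub_nonneg, ← pow_two]
  exact Finset.sum_sq_le_sq_sum_of_nonneg fun i _ => hA.eigenvalues_nonneg i

theorem aux_char {m : ℕ} (i j p q : Fin m) :
    ∑ f : Fin m → ZMod 3, (star (ZMod.stdAddChar (f i)) * ZMod.stdAddChar (f j) *
      (star (ZMod.stdAddChar (f p)) * ZMod.stdAddChar (f q)) : ℂ) =
    if (i = j ∧ p = q) ∨ (i = q ∧ p = j) then (Fintype.card (Fin m → ZMod 3) : ℂ) else 0 := by
  let φ : (Fin m → ZMod 3) →+ ZMod 3 :=
    Pi.evalAddMonoidHom (fun _ : Fin m => ZMod 3) j - Pi.evalAddMonoidHom (fun _ : Fin m => ZMod 3) i +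
      (Pi.evalAddMonoidHom (fun _ : Fin m => ZMod 3) q - Pi.evalAddMonoidHom (fun _ : Fin m => ZMod 3) p)
  let ψ : AddChar (Fin m → ZMod 3) ℂ := ZMod.stdAddChar.compAddMonoidHom φ
  have hψ : ∀ f, ψ f = star (ZMod.stdAddChar (f i)) * ZMod.stdAddChar (f j) *
      (star (ZMod.stdAddChar (f p)) * ZMod.stdAddChar (f q)) := by
    intro f
    have hs : ∀ x : ZMod 3, star (ZMod.stdAddChar x : ℂ) = ZMod.stdAddChar (-x) := by
      intro x
      rw [AddChar.map_neg_eq_conj]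
      rfl
    rw [hs, hs, ← AddChar.map_add_eq_mul, ← AddChar.map_add_eq_mul, ← AddChar.map_add_eq_mul]
    simp only [ψ, φ, AddChar.compAddMonoidHom_apply]
    congr 1
    simp
    ring
  have h0 : ψ = 0 ↔ (i = j ∧ p = q) ∨ (i = q ∧ p = j) := by
    constructor
    · intro h
      have key : ∀ t : Fin m, φ (Pi.single t 1) = 0 := by
        intro t
        have h1 : ψ (Pi.single t 1) = 1 := by rw [h]; simp
        apply ZMod.injective_stdAddChar
        rw [AddChar.map_zero_eq_one]
        exact h1
      have k1 := key i
      have k2 := key p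
      simp only [φ, AddMonoidHom.add_apply, AddMonoidHom.sub_apply, Pi.evalAddMonoidHom_apply,
        Pi.single_apply] at k1 k2
      revert k1 k2
      by_cases a1 : i = j <;> by_cases a2 : i = q <;> by_cases a3 : p = j <;>
        by_cases a4 : p = q <;> by_cases a5 : i = p <;>
        simp_all [eq_comm] <;> decide
    · intro h
      ext f
      have hφ : φ f = 0 := by
        rcases h with ⟨rfl, rfl⟩ | ⟨rfl, rfl⟩ <;> simp [φ]
      simp [ψ, AddChar.compAddMonoidHom_apply, hφ]
  simp_rw [← hψ]
  classical
  rw [AddChar.sum_eq_ite]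
  simp only [h0]

theorem aux_ite {m : ℕ} (i j p q : Fin m) (z : ℂ) :
    (if (i = j ∧ p = q) ∨ (i = q ∧ p = j) then z else 0) =
        (if i = j then (if p = q then z else 0) else 0) +
        (if i = q then (if p = j then z else 0) else 0) -
        (if i = j then (if p = q then (if i = p then z else 0) else 0) else 0) := by
  split_ifs <;> grind

theorem aux_sum6 {m n : ℕ} (F : Fin m → Fin m → Fin m → Fin m → Fin n → Fin n → ℂ) :
    ∑ i, ∑ j, ∑ p, ∑ q, ∑ k, ∑ l, F i j p q k l =
      ∑ k, ∑ l, ∑ i, ∑ j, ∑ p, ∑ q, F i j p q k l := by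
  simp only [← Fintype.sum_prod_type']
  exact Fintype.sum_equiv
    ⟨fun x => (x.2.2.2.2.1, x.2.2.2.2.2, x.1, x.2.1, x.2.2.1, x.2.2.2.1),
      fun x => (x.2.2.1, x.2.2.2.1, x.2.2.2.2.1, x.2.2.2.2.2, x.1, x.2.1),
      fun _ => rfl, fun _ => rfl⟩ _ _ fun _ => rfl

theorem aux_sum4 {m n : ℕ} (F : Fin n → Fin n → Fin m → Fin m → ℂ) :
    ∑ i, ∑ p, ∑ k, ∑ l, F i p k l = ∑ k, ∑ l, ∑ i, ∑ p, F i p k l := by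
  simp only [← Fintype.sum_prod_type']
  exact Fintype.sum_equiv
    ⟨fun x => (x.2.2.1, x.2.2.2, x.1, x.2.1), fun x => (x.2.2.1, x.2.2.2, x.1, x.2.1),
      fun _ => rfl, fun _ => rfl⟩ _ _ fun _ => rfl

theorem aux_avg {m : ℕ} (G : Fin m → Fin m → Fin m → Fin m → ℂ)
    (hG : ∀ a : Fin m → ℂ, 0 ≤ (∑ i, ∑ j, ∑ p, ∑ q,
      star (a i) * a j * (star (a p) * a q) * G i j p q).re) :
    0 ≤ (∑ i, ∑ p, (G i i p p + G i p p i)).re := by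
  have hd : ∀ i, 0 ≤ (G i i i i).re := by
    intro i
    have := hG (Pi.single i 1)
    simpa [Pi.single_apply, apply_ite] using this
  set N : ℂ := (Fintype.card (Fin m → ZMod 3) : ℂ) with hN
  have hsum : ∑ f : Fin m → ZMod 3, ∑ i, ∑ j, ∑ p, ∑ q,
      (star (ZMod.stdAddChar (f i)) * ZMod.stdAddChar (f j) *
      (star (ZMod.stdAddChar (f p)) * ZMod.stdAddChar (f q)) : ℂ) * G i j p q =
      N * (∑ i, ∑ p, (G i i p p + G i p p i) - ∑ i, G i i i i) := by
    have e1 : ∑ f : Fin m → ZMod 3, ∑ i, ∑ j, ∑ p, ∑ q,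
      (star (ZMod.stdAddChar (f i)) * ZMod.stdAddChar (f j) *
      (star (ZMod.stdAddChar (f p)) * ZMod.stdAddChar (f q)) : ℂ) * G i j p q =
      ∑ i, ∑ j, ∑ p, ∑ q, (if (i = j ∧ p = q) ∨ (i = q ∧ p = j) then N else 0) * G i j p q := by
      rw [Finset.sum_comm]; refine Finset.sum_congr rfl fun i _ => ?_
      rw [Finset.sum_comm]; refine Finset.sum_congr rfl fun j _ => ?_
      rw [Finset.sum_comm]; refine Finset.sum_congr rfl fun p _ => ?_
      rw [Finset.sum_comm]; refine Finset.sum_congr rfl fun q _ => ?_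
      rw [← Finset.sum_mul, aux_char]
    have e2 : ∀ i j p q : Fin m,
        (if (i = j ∧ p = q) ∨ (i = q ∧ p = j) then N else 0) * G i j p q =
        (if i = j then (if p = q then N * G i j p q else 0) else 0) +
        (if i = q then (if p = j then N * G i j p q else 0) else 0) -
        (if i = j then (if p = q then (if i = p then N * G i j p q else 0) else 0) else 0) := by
      intro i j p q
      rw [ite_mul, zero_mul]
      exact aux_ite i j p q _
    rw [e1]
    simp_rw [e2, Finset.sum_sub_distrib, Finset.sum_add_distrib]
    have e3 : ∑ i : Fin m, ∑ j : Fin m, ∑ p : Fin m, ∑ q : Fin m,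
        (if i = q then (if p = j then N * G i j p q else 0) else 0) =
        ∑ i : Fin m, ∑ p : Fin m, N * G i p p i := by
      refine Finset.sum_congr rfl fun i _ => ?_
      refine Finset.sum_congr rfl fun j _ => ?_
      rw [Finset.sum_comm]
      simp
    have e4 : ∑ i : Fin m, ∑ j : Fin m, ∑ p : Fin m, ∑ q : Fin m,
        (if i = j then (if p = q then N * G i j p q else 0) else 0) =
        ∑ i : Fin m, ∑ p : Fin m, N * G i i p p := by
      refine Finset.sum_congr rfl fun i _ => ?_
      rw [Finset.sum_eq_single i] <;> simp +contextual [eq_comm]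
    have e5 : ∑ i : Fin m, ∑ j : Fin m, ∑ p : Fin m, ∑ q : Fin m,
        (if i = j then (if p = q then (if i = p then N * G i j p q else 0) else 0) else 0) =
        ∑ i : Fin m, N * G i i i i := by
      refine Finset.sum_congr rfl fun i _ => ?_
      rw [Finset.sum_eq_single i]
      · simp
      · intro b _ hb
        simp [Ne.symm hb]
      · simp
    rw [e3, e4, e5]
    simp only [← Finset.mul_sum]
    ring
  have hpos : 0 ≤ (N * (∑ i, ∑ p, (G i i p p + G i p p i) - ∑ i, G i i i i)).re := by
    rw [← hsum, Complex.re_sum]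
    exact Finset.sum_nonneg fun f _ => hG fun i => ZMod.stdAddChar (f i)
  have hNpos : (0 : ℝ) < (Fintype.card (Fin m → ZMod 3) : ℝ) := by
    exact_mod_cast Fintype.card_pos
  have hN' : N = (((Fintype.card (Fin m → ZMod 3) : ℕ) : ℝ) : ℂ) := by
    rw [hN]; push_cast; rfl
  rw [hN', Complex.re_ofReal_mul, Complex.sub_re, Complex.re_sum (f := fun i => G i i i i)] at hpos
  have h1 := nonneg_of_mul_nonneg_right hpos hNpos
  have h2 : 0 ≤ ∑ i, (G i i i i).re := Finset.sum_nonneg fun i _ => hd i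
  linarith

/-- compression of `W` by `a`. -/
def auxX {m n : ℕ} (W : Matrix (Fin m × Fin n) (Fin m × Fin n) ℂ) (a : Fin m → ℂ) :
    Matrix (Fin n) (Fin n) ℂ :=
  fun k l => ∑ i, ∑ j, star (a i) * a j * W (i, k) (j, l)

theorem auxX_psd {m n : ℕ} {W : Matrix (Fin m × Fin n) (Fin m × Fin n) ℂ}
    (hW : BlockPositive W) (a : Fin m → ℂ) : (auxX W a).PosSemidef := by
  refine .of_dotProduct_mulVec_nonneg ?_ fun b => ?_
  · ext k l
    simp only [auxX, Matrix.conjTranspose_apply, star_sum, star_mul', star_star]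
    rw [Finset.sum_comm]
    refine Finset.sum_congr rfl fun i _ => Finset.sum_congr rfl fun j _ => ?_
    rw [hW.1.apply]
    ring
  · have h : star b ⬝ᵥ (auxX W a).mulVec b = star (prodVec a b) ⬝ᵥ W.mulVec (prodVec a b) := by
      simp only [dotProduct, Matrix.mulVec, auxX, prodVec, Pi.star_apply, Fintype.sum_prod_type,
        Finset.mul_sum, Finset.sum_mul, star_mul']
      simp only [← Fintype.sum_prod_type']
      refine Fintype.sum_equiv
        ⟨fun x => (x.2.2.1, x.1, x.2.2.2, x.2.1), fun x => (x.2.1, x.2.2.2, x.1, x.2.2.1),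
          fun _ => rfl, fun _ => rfl⟩ _ _ fun x => ?_
      simp only [Equiv.coe_fn_mk]
      ring
    rw [h]
    have := hW.2 a b
    rw [Complex.le_def]
    exact ⟨this.1, this.2.symm⟩

theorem aux_T {m n : ℕ} {W : Matrix (Fin m × Fin n) (Fin m × Fin n) ℂ}
    (hW : BlockPositive W) :
    0 ≤ (∑ i, ∑ p, ∑ k, ∑ l, (W (i, k) (i, k) * W (p, l) (p, l) - W (i, k) (i, l) * W (p, l) (p, k)
      + (W (i, k) (p, k) * W (p, l) (i, l) - W (i, k) (p, l) * W (p, l) (i, k)))).re := by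
  have := aux_avg (fun i j p q => ∑ k, ∑ l,
    (W (i, k) (j, k) * W (p, l) (q, l) - W (i, k) (j, l) * W (p, l) (q, k))) (fun a => by
      have h := aux_psd (auxX_psd hW a)
      convert h using 2
      have e : (auxX W a).trace * (auxX W a).trace - (auxX W a * auxX W a).trace =
        ∑ k, ∑ l, (auxX W a k k * auxX W a l l - auxX W a k l * auxX W a l k) := by
        simp only [Matrix.trace, Matrix.diag, Matrix.mul_apply, Finset.sum_mul_sum,
          Finset.sum_sub_distrib]
      rw [e]
      have e2 : ∀ k l k' l', auxX W a k l * auxX W a k' l' = ∑ i, ∑ j, ∑ p, ∑ q,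
          star (a i) * a j * (star (a p) * a q) * (W (i, k) (j, l) * W (p, k') (q, l')) := by
        intro k l k' l'
        simp only [auxX, Finset.sum_mul]
        simp only [Finset.mul_sum]
        refine Finset.sum_congr rfl fun i _ => Finset.sum_congr rfl fun j _ =>
          Finset.sum_congr rfl fun p _ => Finset.sum_congr rfl fun q _ => ?_
        ring
      simp only [e2, ← Finset.sum_sub_distrib, ← mul_sub]
      simp only [Finset.mul_sum]
      exact aux_sum6 _)
  simpa only [← Finset.sum_add_distrib] using this

theorem aux_swap {m n : ℕ} {W : Matrix (Fin m × Fin n) (Fin m × Fin n) ℂ}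
    (hW : BlockPositive W) : BlockPositive (W.submatrix Prod.swap Prod.swap) := by
  refine ⟨hW.1.submatrix _, fun b a => ?_⟩
  have h : star (prodVec b a) ⬝ᵥ (W.submatrix Prod.swap Prod.swap).mulVec (prodVec b a) =
      star (prodVec a b) ⬝ᵥ W.mulVec (prodVec a b) := by
    simp only [dotProduct, Matrix.mulVec, prodVec, Pi.star_apply, Matrix.submatrix_apply]
    refine Fintype.sum_equiv (Equiv.prodComm _ _) _ _ fun x => ?_
    congr 1
    · simp [mul_comm]
    · refine Fintype.sum_equiv (Equiv.prodComm _ _) _ _ fun y => ?_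
      simp [mul_comm]
  rw [h]
  exact hW.2 a b

theorem aux_upper {m n : ℕ} {W : Matrix (Fin m × Fin n) (Fin m × Fin n) ℂ}
    (hW : BlockPositive W) : ((W * W).trace).re ≤ (W.trace * W.trace).re := by
  have h1 := aux_T hW
  have h2 := aux_T (aux_swap hW)
  simp only [Matrix.submatrix_apply, Prod.swap_prod_mk] at h2
  rw [aux_sum4] at h2
  have h3 := add_nonneg h1 h2
  rw [← Complex.add_re] at h3
  simp only [← Finset.sum_add_distrib] at h3
  have h4 : W.trace * W.trace - (W * W).trace = ∑ i, ∑ p, ∑ k, ∑ l,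
      (W (i, k) (i, k) * W (p, l) (p, l) - W (i, k) (p, l) * W (p, l) (i, k)) := by
    simp only [Matrix.trace, Matrix.diag, Matrix.mul_apply, Finset.sum_mul_sum,
          Finset.sum_sub_distrib, Fintype.sum_prod_type]
    congr 1 <;> exact Finset.sum_congr rfl fun i _ => Finset.sum_comm
  have h5 : 0 ≤ (2 * (W.trace * W.trace - (W * W).trace)).re := by
    rw [h4]
    simp only [Finset.mul_sum]
    refine h3.trans_eq (congrArg Complex.re ?_)
    refine Finset.sum_congr rfl fun i _ => Finset.sum_congr rfl fun j _ =>
      Finset.sum_congr rfl fun p _ => Finset.sum_congr rfl fun q _ => ?_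
    ring
  have h6 : (2 * (W.trace * W.trace - (W * W).trace)).re =
      2 * ((W.trace * W.trace).re - ((W * W).trace).re) := by
    simp
  linarith

theorem aux_lower {N : Type*} [Fintype N] [DecidableEq N] {W : Matrix N N ℂ}
    (hW : W.IsHermitian) (hNP : ¬ W.PosSemidef) (htr : W.trace = 1)
    (hc : (1 : ℝ) < Fintype.card N) :
    1 / ((Fintype.card N : ℝ) - 1) < ((W * W).trace).re := by
  rw [aux_trace_sq hW]
  have hs : ∑ i, hW.eigenvalues i = 1 := by
    have := aux_trace hW
    rw [htr] at this
    exact_mod_cast this.symm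
  rw [hW.posSemidef_iff_eigenvalues_nonneg] at hNP
  obtain ⟨i, hi⟩ : ∃ i, hW.eigenvalues i < 0 := by
    by_contra! h
    exact hNP h
  have hcs := sq_sum_le_card_mul_sum_sq (s := Finset.univ.erase i) (f := hW.eigenvalues)
  have h1 := Finset.add_sum_erase Finset.univ hW.eigenvalues (Finset.mem_univ i)
  have h2 := Finset.add_sum_erase Finset.univ (fun i => hW.eigenvalues i ^ 2) (Finset.mem_univ i)
  have hcard : ((Finset.univ.erase i).card : ℝ) = (Fintype.card N : ℝ) - 1 := by
    rw [Finset.card_erase_of_mem (Finset.mem_univ i), Finset.card_univ, Nat.cast_sub]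
    · simp
    · exact Fintype.card_pos_iff.2 ⟨i⟩
  rw [hcard] at hcs
  rw [div_lt_iff₀ (by linarith), ← h2]
  rw [hs] at h1
  have h3 : 1 < (∑ x ∈ Finset.univ.erase i, hW.eigenvalues x) ^ 2 := by nlinarith
  nlinarith [sq_nonneg (hW.eigenvalues i)]


/-- For a normalized `m × n` entanglement witness,
`1/(mn - 1) < tr(W²) ≤ 1`. -/
theorem stmt_4 {m n : ℕ} (hm : 2 ≤ m) (hn : 2 ≤ n)
    (W : Matrix (Fin m × Fin n) (Fin m × Fin n) ℂ)
    (hBP : BlockPositive W) (hNP : ¬ W.PosSemidef) (htr : W.trace = 1) :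
    1 / ((m : ℝ) * n - 1) < ((W * W).trace).re ∧ ((W * W).trace).re ≤ 1 := by
  constructor
  · have hm' : (2 : ℝ) ≤ m := by exact_mod_cast hm
    have hn' : (2 : ℝ) ≤ n := by exact_mod_cast hn
    have h := aux_lower hBP.1 hNP htr (by simp; nlinarith)
    simpa using h
  · have h := aux_upper hBP
    simpa [htr] using h

end
end

section
/- Let m, n ≥ 2 and let W be a normalized m×n entanglement witness. Then its smallest eigenvalue λ_min(W) satisfies −1/2 ≤ λ_min(W) < 0. -/
open Matrix ComplexOrder

noncomputable section

lemma avg_char {ι : Type*} [Fintype ι] [DecidableEq ι] (i k j l : ι) :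
    ∑ ε : ι → ZMod 3, (ZMod.stdAddChar (ε k + ε j - ε i - ε l) : ℂ) =
      (Fintype.card (ι → ZMod 3) : ℂ) *
       ((if i = k ∧ j = l then 1 else 0) + (if i ≠ k ∧ i = j ∧ k = l then 1 else 0)) := by
  by_cases h : ∀ ε : ι → ZMod 3, ε k + ε j - ε i - ε l = 0
  · have h2 : (i = k ∧ j = l) ∨ (i ≠ k ∧ i = j ∧ k = l) := by
      have h1 := h (Pi.single i 1)
      have h3 := h (Pi.single l 1)
      simp only [Pi.single_apply] at h1 h3
      by_cases a : i = k <;> by_cases b : j = l <;> by_cases c : i = j <;> by_cases d : k = l <;> by_cases e : i = l <;> by_cases f : k = j <;> simp_all (decide := true) <;> revert h1 <;> (try revert h3) <;> split_ifs <;> first | decide | grind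
    simp only [h]
    rcases h2 with h2 | h2
    · simp [h2]
    · obtain ⟨h3, rfl, rfl⟩ := h2
      simp [h3]
  · push Not at h
    obtain ⟨ε0, h0⟩ := h
    have h2 : ¬ (i = k ∧ j = l) ∧ ¬ (i ≠ k ∧ i = j ∧ k = l) := by
      constructor
      · rintro ⟨rfl, rfl⟩; apply h0; ring
      · rintro ⟨-, rfl, rfl⟩; apply h0; ring
    rw [if_neg h2.1, if_neg h2.2, add_zero, mul_zero]
    set S := ∑ ε : ι → ZMod 3, (ZMod.stdAddChar (ε k + ε j - ε i - ε l) : ℂ) with hS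
    have h3 : S = ZMod.stdAddChar (ε0 k + ε0 j - ε0 i - ε0 l) * S := by
      conv_lhs => rw [hS, ← Equiv.sum_comp (Equiv.addLeft ε0)]
      rw [hS, Finset.mul_sum]
      refine Finset.sum_congr rfl fun ε _ => ?_
      rw [← AddChar.map_add_eq_mul]
      congr 1
      simp only [Equiv.coe_addLeft, Pi.add_apply]; ring
    by_contra hne
    have h4 : (ZMod.stdAddChar (ε0 k + ε0 j - ε0 i - ε0 l) : ℂ) = 1 := by
      have : (ZMod.stdAddChar (ε0 k + ε0 j - ε0 i - ε0 l) - 1) * S = 0 := by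
        rw [sub_mul, ← h3]; ring
      rcases mul_eq_zero.1 this with h | h
      · exact sub_eq_zero.1 h
      · exact absurd h hne
    apply h0
    apply ZMod.injective_stdAddChar
    rw [h4, AddChar.map_zero_eq_one]

lemma avg_form {ι : Type*} [Fintype ι] [DecidableEq ι] (B : ι → ι → ι → ι → ℂ)
    (h : ∀ θ : ι → ℂ, 0 ≤ (∑ i, ∑ k, ∑ j, ∑ l, star (θ i) * θ k * θ j * star (θ l) * B i k j l).re) :
    0 ≤ (∑ i, ∑ j, B i i j j + ∑ i, ∑ k, if i ≠ k then B i k i k else 0).re := by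
  have key : ∑ ε : ι → ZMod 3, ∑ i, ∑ k, ∑ j, ∑ l,
      star (ZMod.stdAddChar (ε i) : ℂ) * ZMod.stdAddChar (ε k) * ZMod.stdAddChar (ε j)
        * star (ZMod.stdAddChar (ε l) : ℂ) * B i k j l =
      (Fintype.card (ι → ZMod 3) : ℂ) *
        (∑ i, ∑ j, B i i j j + ∑ i, ∑ k, if i ≠ k then B i k i k else 0) := by
    have e1 : ∀ i k j l, ∑ ε : ι → ZMod 3, 
       star (ZMod.stdAddChar (ε i) : ℂ) * ZMod.stdAddChar (ε k) * ZMod.stdAddChar (ε j)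
        * star (ZMod.stdAddChar (ε l) : ℂ) * B i k j l = 
        (Fintype.card (ι → ZMod 3) : ℂ) * ((if i = k then if j = l then B i k j l else 0 else 0)
         + (if i = j then if k = l then if i ≠ k then B i k j l else 0 else 0 else 0)) := by
      intro i k j l
      rw [← Finset.sum_mul]
      have := avg_char i k j l
      have e2 : ∀ ε : ι → ZMod 3, (ZMod.stdAddChar (ε k + ε j - ε i - ε l) : ℂ) = 
        star (ZMod.stdAddChar (ε i) : ℂ) * ZMod.stdAddChar (ε k) * ZMod.stdAddChar (ε j)
        * star (ZMod.stdAddChar (ε l) : ℂ) := by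
        intro ε
        rw [sub_eq_add_neg, sub_eq_add_neg]
        simp only [AddChar.map_add_eq_mul, AddChar.map_neg_eq_conj, ← starRingEnd_apply]
        ring
      simp only [e2] at this
      rw [this]
      by_cases a : i = k <;> by_cases b : j = l <;> by_cases c : i = j <;> by_cases d : k = l <;> simp [a, b, c, d]
      all_goals try grind
    rw [Finset.sum_comm]
    simp_rw [Finset.sum_comm (s := (Finset.univ : Finset (ι → ZMod 3)))]
    simp only [e1, ← Finset.mul_sum, Finset.sum_add_distrib]
    congr 2
    · simp
    · simp
  have h2 : 0 ≤ (∑ ε : ι → ZMod 3, ∑ i, ∑ k, ∑ j, ∑ l,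
      star (ZMod.stdAddChar (ε i) : ℂ) * ZMod.stdAddChar (ε k) * ZMod.stdAddChar (ε j)
        * star (ZMod.stdAddChar (ε l) : ℂ) * B i k j l).re := by
    rw [Complex.re_sum]
    exact Finset.sum_nonneg fun ε _ => h fun i => ZMod.stdAddChar (ε i)
  rw [key, ← Complex.ofReal_natCast, Complex.re_ofReal_mul] at h2
  exact nonneg_of_mul_nonneg_right h2 (by exact_mod_cast Fintype.card_pos)

lemma avg_prod {m n r : ℕ} (W : Matrix (Fin m × Fin n) (Fin m × Fin n) ℂ)
    (hBP : BlockPositive W) (p : Fin r → Fin m → ℂ) (q : Fin r → Fin n → ℂ) :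
    0 ≤ (star (∑ i, prodVec (p i) (q i)) ⬝ᵥ W.mulVec (∑ i, prodVec (p i) (q i)) +
      ∑ i, ∑ k, if i ≠ k then
        star (prodVec (p i) (q k)) ⬝ᵥ W.mulVec (prodVec (p i) (q k)) else 0).re := by
  have h := avg_form (fun i k j l => star (prodVec (p i) (q k)) ⬝ᵥ W.mulVec (prodVec (p j) (q l)))
  have e1 : star (∑ i, prodVec (p i) (q i)) ⬝ᵥ W.mulVec (∑ i, prodVec (p i) (q i)) =
      ∑ i, ∑ j, star (prodVec (p i) (q i)) ⬝ᵥ W.mulVec (prodVec (p j) (q j)) := by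
    simp only [star_sum, sum_dotProduct]
    simp only [mulVec_sum, dotProduct_sum]
  rw [e1]
  apply h
  intro θ
  have h2 := (hBP.2 (∑ i, θ i • p i) (∑ k, star (θ k) • q k)).1
  have e2 : prodVec (∑ i, θ i • p i) (∑ k, star (θ k) • q k) =
      ∑ i, ∑ k, (θ i * star (θ k)) • prodVec (p i) (q k) := by
    ext x
    simp only [prodVec, Finset.sum_apply, Pi.smul_apply, smul_eq_mul, Finset.sum_mul_sum]
    refine Finset.sum_congr rfl fun i _ => Finset.sum_congr rfl fun k _ => ?_
    ring
  rw [e2] at h2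
  simp only [star_sum, sum_dotProduct, star_smul, smul_dotProduct] at h2
  simp only [mulVec_sum, dotProduct_sum, mulVec_smul, dotProduct_smul, smul_eq_mul,
    Finset.mul_sum] at h2
  convert h2 using 2
  refine Finset.sum_congr rfl fun i _ => Finset.sum_congr rfl fun k _ =>
    Finset.sum_congr rfl fun j _ => Finset.sum_congr rfl fun l _ => ?_
  rw [star_mul', star_star]
  ring

lemma trace_compress {n r : ℕ} (P : Matrix (Fin n) (Fin n) ℂ) (hP : P.PosSemidef)
    (H : Matrix (Fin n) (Fin r) ℂ) (hH : H * Hᴴ * (H * Hᴴ) = H * Hᴴ) :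
    (Hᴴ * P * H).trace.re ≤ P.trace.re := by
  have h1 := (hP.conjTranspose_mul_mul_same (1 - H * Hᴴ)).trace_nonneg
  have h2 : ((1 - H * Hᴴ)ᴴ * P * (1 - H * Hᴴ)).trace = P.trace - (Hᴴ * P * H).trace := by
    have e : (1 - H * Hᴴ)ᴴ = 1 - H * Hᴴ := by simp
    have e2 : (1 - H * Hᴴ) * (1 - H * Hᴴ) = 1 - H * Hᴴ := by
      rw [sub_mul, mul_sub, mul_sub, hH]; simp
    rw [e, Matrix.trace_mul_cycle, e2, sub_mul, one_mul, Matrix.trace_sub]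
    congr 1
    rw [Matrix.mul_assoc, Matrix.trace_mul_comm]
  rw [h2] at h1
  have := (Complex.le_def.1 h1).1
  simp at this
  linarith

lemma schmidt {m n : ℕ} (v : Fin m × Fin n → ℂ) (hv : star v ⬝ᵥ v = 1) :
    ∃ (U : Matrix (Fin m) (Fin m) ℂ) (s : Fin m → ℝ) (H : Matrix (Fin n) (Fin m) ℂ),
      U * Uᴴ = 1 ∧ (∀ i, 0 ≤ s i) ∧ ∑ i, s i ^ 2 = 1 ∧ H * Hᴴ * (H * Hᴴ) = H * Hᴴ ∧
      v = ∑ i, (s i : ℂ) • prodVec (fun x => U x i) (fun y => H y i) := by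
  let V : Matrix (Fin m) (Fin n) ℂ := Matrix.of fun x y => v (x, y)
  have hA : (V * Vᴴ).PosSemidef := posSemidef_self_mul_conjTranspose V
  let U : Matrix (Fin m) (Fin m) ℂ := hA.1.eigenvectorUnitary
  let l : Fin m → ℝ := hA.1.eigenvalues
  have hl : ∀ i, 0 ≤ l i := hA.eigenvalues_nonneg
  have hU1 : U * Uᴴ = 1 := (Unitary.mem_iff.1 hA.1.eigenvectorUnitary.2).2
  have hU2 : Uᴴ * U = 1 := (Unitary.mem_iff.1 hA.1.eigenvectorUnitary.2).1
  have hsp : V * Vᴴ = U * diagonal (fun i => (l i : ℂ)) * Uᴴ := by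
    have := hA.1.spectral_theorem
    rw [Unitary.conjStarAlgAut_apply] at this
    exact this
  let G := Uᴴ * V
  have hG : G * Gᴴ = diagonal (fun i => (l i : ℂ)) := by
    calc G * Gᴴ = Uᴴ * (V * Vᴴ) * U := by simp [G, Matrix.mul_assoc]
      _ = (Uᴴ * U) * diagonal (fun i => (l i : ℂ)) * (Uᴴ * U) := by
        rw [hsp]; simp only [Matrix.mul_assoc]
      _ = _ := by rw [hU2]; simp
  have hV : V = U * G := by
    simp only [G]; rw [← Matrix.mul_assoc, hU1, Matrix.one_mul]
  have hsum : ∑ i, l i = 1 := by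
    have h1 := hA.1.trace_eq_sum_eigenvalues
    have h2 : (V * Vᴴ).trace = star v ⬝ᵥ v := by
      simp only [Matrix.trace, Matrix.diag, Matrix.mul_apply, dotProduct, Fintype.sum_prod_type,
        conjTranspose_apply, V, Matrix.of_apply, Pi.star_apply]
      refine Finset.sum_congr rfl fun i _ => Finset.sum_congr rfl fun k _ => mul_comm _ _
    rw [h2, hv] at h1
    have h3 : ((∑ i, l i : ℝ) : ℂ) = 1 := by rw [h1]; push_cast; rfl
    exact_mod_cast h3
  let s : Fin m → ℝ := fun i => Real.sqrt (l i)
  have hs : ∀ i, s i ^ 2 = l i := fun i => Real.sq_sqrt (hl i)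
  let F : Matrix (Fin m) (Fin n) ℂ := diagonal (fun i => ((s i)⁻¹ : ℂ)) * G
  have hF : F * Fᴴ * F = F := by
    have e1 : F * Fᴴ = diagonal (fun i => ((s i)⁻¹ : ℂ) * (l i) * (s i)⁻¹) := by
      simp only [F, conjTranspose_mul, diagonal_conjTranspose]
      rw [Matrix.mul_assoc, ← Matrix.mul_assoc G, hG, ← Matrix.mul_assoc,
        diagonal_mul_diagonal, diagonal_mul_diagonal]
      congr 1
      ext i
      simp
    rw [e1]
    simp only [F]
    rw [← Matrix.mul_assoc, diagonal_mul_diagonal]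
    congr 2
    ext i
    rw [← hs]
    by_cases h : s i = 0
    · simp [h]
    · have : (s i : ℂ) ≠ 0 := by exact_mod_cast h
      push_cast
      field_simp
  refine ⟨U, s, Fᵀ, hU1, fun i => Real.sqrt_nonneg _, by simp only [hs, hsum], ?_, ?_⟩
  · have e : Fᵀ * Fᵀᴴ = (Fᴴ * F)ᵀ := by
      rw [Matrix.transpose_mul Fᴴ F]; rfl
    rw [e, ← Matrix.transpose_mul]
    congr 1
    calc Fᴴ * F * (Fᴴ * F) = Fᴴ * (F * Fᴴ * F) := by simp only [Matrix.mul_assoc]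
      _ = _ := by rw [hF]
  · ext ⟨x, y⟩
    have h1 : v (x, y) = (U * G) x y := by rw [← hV]; rfl
    rw [h1, Matrix.mul_apply, Finset.sum_apply]
    refine Finset.sum_congr rfl fun i _ => ?_
    simp only [Pi.smul_apply, prodVec, smul_eq_mul, transpose_apply, F, diagonal_mul]
    by_cases h : s i = 0
    · have h2 : G i ⬝ᵥ star (G i) = 0 := by
        have h3 := congrFun (congrFun hG i) i
        rw [diagonal_apply_eq, ← hs, h] at h3
        rw [Matrix.mul_apply] at h3
        simpa [dotProduct] using h3
      have h4 : G i = 0 := dotProduct_self_star_eq_zero.1 h2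
      simp [h4]
    · have : (s i : ℂ) ≠ 0 := by exact_mod_cast h
      field_simp

/-- The embedding `b ↦ e ⊗ b` as a matrix. -/
def embMat {m : ℕ} (n : ℕ) (e : Fin m → ℂ) : Matrix (Fin m × Fin n) (Fin n) ℂ :=
  Matrix.of fun p z => if p.2 = z then e p.1 else 0

lemma embMat_mulVec {m n : ℕ} (e : Fin m → ℂ) (b : Fin n → ℂ) :
    embMat n e *ᵥ b = prodVec e b := by
  ext ⟨x, y⟩
  simp [embMat, mulVec, dotProduct, prodVec]

lemma quad_conj {N M : Type*} [Fintype N] [Fintype M] (W : Matrix N N ℂ) (A : Matrix N M ℂ)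
    (b : M → ℂ) : star b ⬝ᵥ (Aᴴ * W * A) *ᵥ b = star (A *ᵥ b) ⬝ᵥ W *ᵥ (A *ᵥ b) := by
  rw [star_mulVec, ← dotProduct_mulVec, mulVec_mulVec, mulVec_mulVec, Matrix.mul_assoc]

lemma sum_le_trace {m n r : ℕ} (W : Matrix (Fin m × Fin n) (Fin m × Fin n) ℂ)
    (hBP : BlockPositive W) (U : Matrix (Fin m) (Fin m) ℂ) (hU : U * Uᴴ = 1)
    (H : Matrix (Fin n) (Fin r) ℂ) (hH : H * Hᴴ * (H * Hᴴ) = H * Hᴴ) :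
    ∑ i, ∑ k, (star (prodVec (fun x => U x i) (fun y => H y k)) ⬝ᵥ
      W.mulVec (prodVec (fun x => U x i) (fun y => H y k))).re ≤ W.trace.re := by
  let A : Fin m → Matrix (Fin m × Fin n) (Fin n) ℂ := fun i => embMat n (fun x => U x i)
  have hP : ∀ i, ((A i)ᴴ * W * A i).PosSemidef := by
    intro i
    refine PosSemidef.of_dotProduct_mulVec_nonneg
      (isHermitian_conjTranspose_mul_mul _ hBP.1) fun b => ?_
    rw [quad_conj, embMat_mulVec]
    have := hBP.2 (fun x => U x i) b
    exact Complex.le_def.2 ⟨this.1, this.2.symm⟩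
  have h1 : ∀ i, ∑ k, (star (prodVec (fun x => U x i) (fun y => H y k)) ⬝ᵥ
      W.mulVec (prodVec (fun x => U x i) (fun y => H y k))).re ≤ ((A i)ᴴ * W * A i).trace.re := by
    intro i
    refine le_trans (le_of_eq ?_) (trace_compress _ (hP i) H hH)
    rw [Matrix.trace, Complex.re_sum]
    refine Finset.sum_congr rfl fun k _ => ?_
    rw [← embMat_mulVec, ← quad_conj]
    congr 1
    rw [Matrix.diag, Matrix.mul_assoc Hᴴ, Matrix.mul_apply]
    rfl
  refine le_trans (Finset.sum_le_sum fun i _ => h1 i) (le_of_eq ?_)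
  rw [← Complex.re_sum]
  congr 1
  have h2 : ∑ i, A i * (A i)ᴴ = 1 := by
    ext ⟨x, y⟩ ⟨x', y'⟩
    have h3 := congrFun (congrFun hU x) x'
    rw [Matrix.mul_apply] at h3
    simp only [conjTranspose_apply] at h3
    rw [Matrix.sum_apply]
    simp only [A, embMat, Matrix.mul_apply, conjTranspose_apply, Matrix.of_apply]
    by_cases hy : y = y'
    · subst hy
      simp only [ite_mul, zero_mul, Finset.sum_ite_eq, Finset.mem_univ, if_true, h3]
      simp [Matrix.one_apply]
    · have : ¬ (y' = y) := fun h => hy h.symm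
      simp [Matrix.one_apply, hy, this]
  calc ∑ i, ((A i)ᴴ * W * A i).trace = ∑ i, (A i * (A i)ᴴ * W).trace :=
        Finset.sum_congr rfl fun i _ => Matrix.trace_mul_cycle _ _ _
    _ = ((∑ i, A i * (A i)ᴴ) * W).trace := by rw [Finset.sum_mul, Matrix.trace_sum]
    _ = W.trace := by rw [h2, Matrix.one_mul]

lemma quad_lower {m n : ℕ} (W : Matrix (Fin m × Fin n) (Fin m × Fin n) ℂ)
    (hBP : BlockPositive W) (v : Fin m × Fin n → ℂ) (hv : star v ⬝ᵥ v = 1) :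
    -(1 / 2) * W.trace.re ≤ (star v ⬝ᵥ W.mulVec v).re := by
  obtain ⟨U, s, H, hU, hs0, hs1, hH, hvs⟩ := schmidt v hv
  have h1 := sum_le_trace W hBP U hU H hH
  have h2 := avg_prod W hBP (fun i x => (Real.sqrt (s i) : ℂ) * U x i)
    (fun i y => (Real.sqrt (s i) : ℂ) * H y i)
  have e : ∀ i k, prodVec (fun x => (Real.sqrt (s i) : ℂ) * U x i)
      (fun y => (Real.sqrt (s k) : ℂ) * H y k) =
      ((Real.sqrt (s i) * Real.sqrt (s k) : ℝ) : ℂ) •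
        prodVec (fun x => U x i) (fun y => H y k) := by
    intro i k
    ext x
    simp only [prodVec, Pi.smul_apply, smul_eq_mul]
    push_cast
    ring
  have hv2 : ∑ i, prodVec (fun x => (Real.sqrt (s i) : ℂ) * U x i)
      (fun y => (Real.sqrt (s i) : ℂ) * H y i) = v := by
    rw [hvs]
    refine Finset.sum_congr rfl fun i _ => ?_
    rw [e, Real.mul_self_sqrt (hs0 i)]
  rw [hv2, Complex.add_re, Complex.re_sum] at h2
  have h3 : ∀ i, (∑ k, if i ≠ k then
      star (prodVec (fun x => (Real.sqrt (s i) : ℂ) * U x i)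
        (fun y => (Real.sqrt (s k) : ℂ) * H y k)) ⬝ᵥ
      W.mulVec (prodVec (fun x => (Real.sqrt (s i) : ℂ) * U x i)
        (fun y => (Real.sqrt (s k) : ℂ) * H y k)) else 0).re ≤
      (1 / 2) * ∑ k, (star (prodVec (fun x => U x i) (fun y => H y k)) ⬝ᵥ
        W.mulVec (prodVec (fun x => U x i) (fun y => H y k))).re := by
    intro i
    rw [Complex.re_sum, Finset.mul_sum]
    refine Finset.sum_le_sum fun k _ => ?_
    have h4 := (hBP.2 (fun x => U x i) (fun y => H y k)).1
    split_ifs with hik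
    · rw [e, star_smul, mulVec_smul, smul_dotProduct, dotProduct_smul, smul_eq_mul, smul_eq_mul,
        ← mul_assoc, Complex.star_def, Complex.conj_ofReal, ← Complex.ofReal_mul,
        Complex.re_ofReal_mul]
      refine mul_le_mul_of_nonneg_right ?_ h4
      have h5 : s i ^ 2 + s k ^ 2 ≤ 1 := by
        rw [← hs1, ← Finset.sum_pair (f := fun i => s i ^ 2) hik]
        exact Finset.sum_le_sum_of_subset_of_nonneg (Finset.subset_univ _)
          fun j _ _ => sq_nonneg _
      have h6 : Real.sqrt (s i) * Real.sqrt (s k) * (Real.sqrt (s i) * Real.sqrt (s k)) =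
          s i * s k := by
        rw [mul_mul_mul_comm, Real.mul_self_sqrt (hs0 i), Real.mul_self_sqrt (hs0 k)]
      rw [h6]
      nlinarith [sq_nonneg (s i - s k)]
    · simp only [Complex.zero_re]
      positivity
  have h7 := Finset.sum_le_sum (s := Finset.univ) fun i _ => h3 i
  rw [← Finset.mul_sum] at h7
  linarith

/-- For a normalized `m × n` entanglement witness, `-1/2 ≤ λ_min(W) < 0`. -/
theorem stmt_5 {m n : ℕ} (hm : 2 ≤ m) (hn : 2 ≤ n)
    (W : Matrix (Fin m × Fin n) (Fin m × Fin n) ℂ)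
    (hBP : BlockPositive W) (hNP : ¬ W.PosSemidef) (htr : W.trace = 1) :
    -(1 / 2) ≤ (⨅ i, hBP.1.eigenvalues i) ∧ (⨅ i, hBP.1.eigenvalues i) < 0 := by
  constructor
  · have : Nonempty (Fin m × Fin n) := ⟨(⟨0, by omega⟩, ⟨0, by omega⟩)⟩
    refine le_ciInf fun i => ?_
    rw [hBP.1.eigenvalues_eq i]
    have hv : star (hBP.1.eigenvectorBasis i).ofLp ⬝ᵥ (hBP.1.eigenvectorBasis i).ofLp = 1 := by
      have h1 := hBP.1.eigenvectorBasis.inner_eq_one i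
      rw [EuclideanSpace.inner_eq_star_dotProduct, dotProduct_comm] at h1
      exact h1
    have h2 := quad_lower W hBP _ hv
    rw [htr] at h2
    simpa using h2
  · rw [hBP.1.posSemidef_iff_eigenvalues_nonneg, Pi.le_def] at hNP
    push Not at hNP
    obtain ⟨i, hi⟩ := hNP
    exact lt_of_le_of_lt (ciInf_le (Set.finite_range _).bddBelow i) hi

end
end

section
/- Let n ≥ 2 and let W be a normalized 2×n entanglement witness with eigenvalues λ_1 ≥ λ_2 ≥ … ≥ λ_{2n} listed in non-increasing order with multiplicity. Then the sum of all eigenvalues except the two largest satisfies ∑_{i=3}^{2n} λ_i ≥ −1/(2 + 2√2). -/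
open Matrix ComplexOrder

noncomputable section

lemma onb_unitary {n : ℕ} (b : OrthonormalBasis (Fin n) ℂ (EuclideanSpace ℂ (Fin n))) :
    (Matrix.of fun k l => b l k)ᴴ * (Matrix.of fun k l => b l k) = 1 := by
  ext i j
  have h := orthonormal_iff_ite.mp b.orthonormal i j
  rw [EuclideanSpace.inner_eq_star_dotProduct] at h
  simp only [Matrix.mul_apply, Matrix.conjTranspose_apply, Matrix.of_apply, Matrix.one_apply]
  rw [← h]
  simp only [dotProduct, Pi.star_apply]
  exact Finset.sum_congr rfl fun k _ => mul_comm _ _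

lemma exists_onb_of_orthogonal {n : ℕ} (A : Matrix (Fin n) (Fin n) ℂ) (d : Fin n → ℝ)
    (hd : ∀ i, 0 ≤ d i)
    (hA : Aᴴ * A = Matrix.diagonal fun i => ((d i ^ 2 : ℝ) : ℂ)) :
    ∃ E : Matrix (Fin n) (Fin n) ℂ, Eᴴ * E = 1 ∧ A = E * Matrix.diagonal fun i => (d i : ℂ) := by
  let v : Fin n → EuclideanSpace ℂ (Fin n) := fun j => WithLp.toLp 2 (fun k => A k j)
  have hv : ∀ i j, inner ℂ (v i) (v j) = if i = j then ((d i ^ 2 : ℝ) : ℂ) else 0 := by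
    intro i j
    have := congrFun (congrFun hA i) j
    rw [Matrix.diagonal_apply] at this
    rw [← this, EuclideanSpace.inner_eq_star_dotProduct]
    simp only [Matrix.mul_apply, Matrix.conjTranspose_apply, dotProduct, Pi.star_apply]
    exact Finset.sum_congr rfl fun k _ => mul_comm _ _
  have hnorm : ∀ i, ‖v i‖ = d i := by
    intro i
    have h1 := hv i i
    rw [inner_self_eq_norm_sq_to_K, if_pos rfl] at h1
    have h2 : ‖v i‖ ^ 2 = d i ^ 2 := by
      apply Complex.ofReal_injective
      simpa using h1
    exact (sq_eq_sq₀ (norm_nonneg _) (hd i)).mp h2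
  let s : Set (Fin n) := {i | d i ≠ 0}
  let u : Fin n → EuclideanSpace ℂ (Fin n) := fun i => ((d i)⁻¹ : ℂ) • v i
  have hon : Orthonormal ℂ (s.domRestrict u) := by
    rw [orthonormal_iff_ite]
    rintro ⟨i, hi⟩ ⟨j, hj⟩
    have hi' : (d i : ℂ) ≠ 0 := by exact_mod_cast hi
    show inner ℂ (u i) (u j) = _
    simp only [u, inner_smul_left, inner_smul_right, hv, Subtype.mk.injEq]
    split_ifs with h
    · subst h
      simp
      field_simp
    · simp
  obtain ⟨b, hb⟩ := hon.exists_orthonormalBasis_extension_of_card_eq (by simp)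
  refine ⟨Matrix.of fun k l => b l k, onb_unitary b, ?_⟩
  ext k j
  rw [Matrix.mul_diagonal, Matrix.of_apply]
  by_cases h : d j = 0
  · have h0 : v j = 0 := by rw [← norm_eq_zero, hnorm, h]
    have : v j k = 0 := by rw [h0]; rfl
    rw [h]; simpa using this
  · rw [hb j h]
    have : (d j : ℂ) ≠ 0 := by exact_mod_cast h
    simp [u, v]
    field_simp

lemma unitary_diag {n : ℕ} (U : Matrix (Fin n) (Fin n) ℂ) (hU : Uᴴ * U = 1) :
    ∃ (V : Matrix (Fin n) (Fin n) ℂ) (w : Fin n → ℂ), Vᴴ * V = 1 ∧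
      U * V = V * Matrix.diagonal w := by
  have hU' : U * Uᴴ = 1 := mul_eq_one_comm.mp hU
  let P : Matrix (Fin n) (Fin n) ℂ := U + Uᴴ
  let Q : Matrix (Fin n) (Fin n) ℂ := Complex.I • (U - Uᴴ)
  have hP : P.IsHermitian := by
    simp [P, Matrix.IsHermitian, add_comm]
  have hQ : Q.IsHermitian := by
    simp only [Q, Matrix.IsHermitian, Matrix.conjTranspose_smul, Matrix.conjTranspose_sub,
      Matrix.conjTranspose_conjTranspose]
    simp [smul_sub]
    abel
  have hPQ : P * Q = Q * P := by
    simp only [P, Q, mul_smul_comm, smul_mul_assoc]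
    congr 1
    simp only [add_mul, mul_sub, sub_mul, mul_add, hU, hU']
    abel
  have hA := Matrix.isSymmetric_toEuclideanLin_iff.mpr hP
  have hB := Matrix.isSymmetric_toEuclideanLin_iff.mpr hQ
  have hAB : Commute (Matrix.toEuclideanLin P) (Matrix.toEuclideanLin Q) := by
    show _ * _ = _ * _
    apply LinearMap.ext
    intro x
    simp only [Module.End.mul_apply, Matrix.toLpLin_apply, Matrix.mulVec_mulVec, hPQ]
  have hdec := LinearMap.IsSymmetric.directSum_isInternal_of_commute hA hB hAB
  have hof := LinearMap.IsSymmetric.orthogonalFamily_eigenspace_inf_eigenspace hA hB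
  have hdecRaw := DirectSum.isInternal_ne_bot_iff.mpr hdec
  have hfin := WellFoundedGT.finite_ne_bot_of_iSupIndep hdec.submodule_iSupIndep
  let VV := fun i : ℂ × ℂ =>
    (Module.End.eigenspace (Matrix.toEuclideanLin P) i.2 ⊓
      Module.End.eigenspace (Matrix.toEuclideanLin Q) i.1)
  have hdecNz : DirectSum.IsInternal (fun i : {i // VV i ≠ ⊥} => VV i) := hdecRaw
  let _ : Fintype {i // VV i ≠ ⊥} := hfin.fintype
  have hof' : OrthogonalFamily ℂ (fun i : {i // VV i ≠ ⊥} => VV i)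
      (fun i => (VV i).subtypeₗᵢ) := hof.comp Subtype.val_injective
  have hn : Module.finrank ℂ (EuclideanSpace ℂ (Fin n)) = n := by simp
  let b := hdecNz.subordinateOrthonormalBasis hn hof'
  have hb : ∀ a, b a ∈ VV (hdecNz.subordinateOrthonormalBasisIndex hn a hof').1 := fun a =>
    hdecNz.subordinateOrthonormalBasis_subordinate hn a hof'
  let w : Fin n → ℂ := fun a =>
    ((hdecNz.subordinateOrthonormalBasisIndex hn a hof').1.2
      - Complex.I * (hdecNz.subordinateOrthonormalBasisIndex hn a hof').1.1) / 2
  refine ⟨Matrix.of fun k l => b l k, w, onb_unitary b, ?_⟩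
  ext k l
  have h1 := Module.End.mem_eigenspace_iff.mp (hb l).1
  have h2 := Module.End.mem_eigenspace_iff.mp (hb l).2
  rw [Matrix.toLpLin_apply] at h1 h2
  have h1' : (P *ᵥ (b l).ofLp) k = _ := congrArg (fun v : EuclideanSpace ℂ (Fin n) => v k) h1
  have h2' : (Q *ᵥ (b l).ofLp) k = _ := congrArg (fun v : EuclideanSpace ℂ (Fin n) => v k) h2
  simp only [P, Q, Matrix.add_mulVec, Matrix.smul_mulVec, Matrix.sub_mulVec, Pi.add_apply,
    Pi.smul_apply, Pi.sub_apply, smul_eq_mul, PiLp.smul_apply] at h1' h2'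
  rw [Matrix.mul_diagonal, Matrix.of_apply]
  have : (U * Matrix.of fun k l => b l k) k l = (U *ᵥ (b l).ofLp) k := rfl
  rw [this]
  simp only [w]
  linear_combination (1 / 2) * h1' - Complex.I / 2 * h2' + (1/2) *
    ((U *ᵥ (b l).ofLp) k - (Uᴴ *ᵥ (b l).ofLp) k) * Complex.I_sq

/-- The blocks of `W`. -/
def blk {n : ℕ} (W : Matrix (Fin 2 × Fin n) (Fin 2 × Fin n) ℂ) (i j : Fin 2) :
    Matrix (Fin n) (Fin n) ℂ := Matrix.of fun k l => W (i, k) (j, l)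

lemma blk_conj {n : ℕ} {W : Matrix (Fin 2 × Fin n) (Fin 2 × Fin n) ℂ} (hW : W.IsHermitian)
    (i j : Fin 2) : (blk W i j)ᴴ = blk W j i := by
  ext k l
  exact hW.apply (j, k) (i, l)

lemma trace_blk {n : ℕ} (W : Matrix (Fin 2 × Fin n) (Fin 2 × Fin n) ℂ) :
    W.trace = (blk W 0 0).trace + (blk W 1 1).trace := by
  simp [Matrix.trace, Fintype.sum_prod_type, blk]

lemma form_blk {n : ℕ} {ι : Type*} [Fintype ι] (W : Matrix (Fin 2 × Fin n) (Fin 2 × Fin n) ℂ)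
    (M : Matrix (Fin 2 × Fin n) ι ℂ) (A B : Matrix (Fin n) ι ℂ)
    (hA : ∀ k j, M (0, k) j = A k j) (hB : ∀ k j, M (1, k) j = B k j) :
    Mᴴ * W * M = Aᴴ * blk W 0 0 * A + Aᴴ * blk W 0 1 * B + Bᴴ * blk W 1 0 * A
      + Bᴴ * blk W 1 1 * B := by
  ext i j
  simp only [Matrix.mul_apply, Matrix.add_apply, Matrix.conjTranspose_apply,
    Fintype.sum_prod_type, Fin.sum_univ_two, hA, hB, blk, Matrix.of_apply, add_mul,
    Finset.sum_add_distrib]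
  ring

lemma bp_col {n : ℕ} {ι : Type*} [Fintype ι] (W : Matrix (Fin 2 × Fin n) (Fin 2 × Fin n) ℂ)
    (hW : BlockPositive W) (a : ι → Fin 2 → ℂ) (V : Matrix (Fin n) ι ℂ) (j : ι) :
    0 ≤ (((Matrix.of fun p j => a j p.1 * V p.2 j : Matrix (Fin 2 × Fin n) ι ℂ)ᴴ * W *
      (Matrix.of fun p j => a j p.1 * V p.2 j : Matrix (Fin 2 × Fin n) ι ℂ)) j j).re := by
  have h := (hW.2 (a j) (fun k => V k j)).1
  rw [Matrix.mul_assoc]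
  exact h

lemma bp_trace {n : ℕ} {W : Matrix (Fin 2 × Fin n) (Fin 2 × Fin n) ℂ}
    (hW : BlockPositive W) (U : Matrix (Fin n) (Fin n) ℂ) (hU : Uᴴ * U = 1) :
    0 ≤ (blk W 0 0).trace.re + (blk W 1 1).trace.re + 2 * (blk W 0 1 * U).trace.re := by
  obtain ⟨V, w, hV, hUV⟩ := unitary_diag U hU
  have hV' : V * Vᴴ = 1 := mul_eq_one_comm.mp hV
  let M : Matrix (Fin 2 × Fin n) (Fin n) ℂ := Matrix.of fun p j => ![1, w j] p.1 * V p.2 j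
  have h1 : 0 ≤ (Mᴴ * W * M).trace.re := by
    rw [Matrix.trace, Complex.re_sum]
    exact Finset.sum_nonneg fun j _ => bp_col W hW (fun j => ![1, w j]) V j
  rw [form_blk W M V (U * V) (by simp [M]) (by
    intro k j; rw [hUV, Matrix.mul_diagonal]; simp [M, mul_comm])] at h1
  have e1 : (Vᴴ * blk W 0 0 * V).trace = (blk W 0 0).trace := by
    rw [Matrix.trace_mul_cycle, hV', Matrix.one_mul]
  have e2 : (Vᴴ * blk W 0 1 * (U * V)).trace = (blk W 0 1 * U).trace := by
    rw [← Matrix.mul_assoc, Matrix.trace_mul_comm, ← Matrix.mul_assoc, ← Matrix.mul_assoc, hV',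
      Matrix.one_mul]
  have e3 : ((U * V)ᴴ * blk W 1 0 * V).trace = star (blk W 0 1 * U).trace := by
    rw [← e2, ← Matrix.trace_conjTranspose, ← blk_conj hW.1 0 1]
    simp [Matrix.mul_assoc]
  have e4 : ((U * V)ᴴ * blk W 1 1 * (U * V)).trace = (blk W 1 1).trace := by
    have : U * V * (U * V)ᴴ = 1 := by
      rw [Matrix.conjTranspose_mul, Matrix.mul_assoc, ← Matrix.mul_assoc V, hV', Matrix.one_mul,
        mul_eq_one_comm.mp hU]
    rw [Matrix.trace_mul_cycle, this, Matrix.one_mul]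
  simp only [Matrix.trace_add, e1, e2, e3, e4, Complex.add_re, Complex.star_def,
    Complex.conj_re] at h1
  linarith

lemma bp_diag {n : ℕ} {W : Matrix (Fin 2 × Fin n) (Fin 2 × Fin n) ℂ}
    (hW : BlockPositive W) (i : Fin 2) (E : Matrix (Fin n) (Fin n) ℂ) (j : Fin n) :
    0 ≤ ((Eᴴ * blk W i i * E) j j).re := by
  have h := bp_col W hW (fun _ => Pi.single i 1) E j
  fin_cases i
  · rw [form_blk W _ E 0 (by simp) (by simp)] at h
    simpa using h
  · rw [form_blk W _ 0 E (by simp) (by simp)] at h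
    simpa using h

lemma core_ineq {n : ℕ} {W : Matrix (Fin 2 × Fin n) (Fin 2 × Fin n) ℂ}
    (hW : BlockPositive W) (A B : Matrix (Fin n) (Fin n) ℂ) (d d' : Fin n → ℝ)
    (hd : ∀ i, 0 ≤ d i) (hd' : ∀ i, 0 ≤ d' i)
    (hA : Aᴴ * A = Matrix.diagonal fun i => ((d i ^ 2 : ℝ) : ℂ))
    (hB : Bᴴ * B = Matrix.diagonal fun i => ((d' i ^ 2 : ℝ) : ℂ))
    (m p c : ℝ) (S : Finset (Fin n)) (hdm : ∀ i, d i ^ 2 ≤ m) (hdm' : ∀ i, d' i ^ 2 ≤ m)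
    (hp : ∀ i, d i * d' i = if i ∈ S then p else 0) (hp0 : 0 ≤ p) (hpc : p ≤ c - m) :
    (Aᴴ * blk W 0 0 * A).trace.re + (Bᴴ * blk W 1 1 * B).trace.re
      + 2 * (Aᴴ * blk W 0 1 * B).trace.re ≤ c * W.trace.re := by
  obtain ⟨E, hE, rfl⟩ := exists_onb_of_orthogonal A d hd hA
  obtain ⟨F, hF, rfl⟩ := exists_onb_of_orthogonal B d' hd' hB
  have hE' : E * Eᴴ = 1 := mul_eq_one_comm.mp hE
  have hF' : F * Fᴴ = 1 := mul_eq_one_comm.mp hF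
  have tr : ∀ (D D' : Fin n → ℝ) (G H Y : Matrix (Fin n) (Fin n) ℂ),
      ((G * Matrix.diagonal fun i => (D i : ℂ))ᴴ * Y *
        (H * Matrix.diagonal fun i => (D' i : ℂ))).trace.re =
      ∑ k, D k * D' k * ((Gᴴ * Y * H) k k).re := by
    intro D D' G H Y
    have : (G * Matrix.diagonal fun i => (D i : ℂ))ᴴ * Y *
        (H * Matrix.diagonal fun i => (D' i : ℂ)) =
        (Matrix.diagonal fun i => (D i : ℂ)) * (Gᴴ * Y * H) *
          (Matrix.diagonal fun i => (D' i : ℂ)) := by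
      rw [Matrix.conjTranspose_mul, Matrix.diagonal_conjTranspose]
      simp only [Matrix.mul_assoc]
      congr 2
      ext i
      simp
    rw [this, Matrix.trace, Complex.re_sum]
    refine Finset.sum_congr rfl fun k _ => ?_
    rw [Matrix.diag_apply, Matrix.mul_diagonal, Matrix.diagonal_mul]
    simp
    ring
  have sg : ∀ (ε : Fin n → ℝ), (∀ i, ε i ^ 2 = 1) →
      0 ≤ W.trace.re + 2 * ∑ k, ε k * ((Eᴴ * blk W 0 1 * F) k k).re := by
    intro ε hε
    let D : Matrix (Fin n) (Fin n) ℂ := Matrix.diagonal fun i => (ε i : ℂ)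
    have hDD : Dᴴ * D = 1 := by
      rw [Matrix.diagonal_conjTranspose, Matrix.diagonal_mul_diagonal, ← Matrix.diagonal_one]
      congr 1
      ext i
      have := hε i
      simp only [Pi.star_apply, Complex.star_def, Complex.conj_ofReal]
      rw [← sq]
      exact_mod_cast this
    have hU : (F * D * Eᴴ)ᴴ * (F * D * Eᴴ) = 1 := by
      simp only [Matrix.conjTranspose_mul, Matrix.conjTranspose_conjTranspose]
      calc E * (Dᴴ * Fᴴ) * (F * D * Eᴴ) = E * (Dᴴ * (Fᴴ * F) * D) * Eᴴ := by
            simp only [Matrix.mul_assoc]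
        _ = 1 := by rw [hF, Matrix.mul_one, hDD, Matrix.mul_one, hE']
    have h := bp_trace hW _ hU
    have h2 : (blk W 0 1 * (F * D * Eᴴ)).trace.re
        = ∑ k, ε k * ((Eᴴ * blk W 0 1 * F) k k).re := by
      have := tr (fun _ => 1) ε E F (blk W 0 1)
      simp only [one_mul] at this
      rw [← this, ← Matrix.mul_assoc, Matrix.trace_mul_comm]
      simp [D, Matrix.mul_assoc]
    rw [h2] at h
    rw [trace_blk, Complex.add_re]
    exact h
  have hs : 2 * ∑ k ∈ S, ((Eᴴ * blk W 0 1 * F) k k).re ≤ W.trace.re := by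
    have s1 := sg (fun k => if k ∈ S then -1 else 1) (by intro i; split_ifs <;> norm_num)
    have s2 := sg (fun k => if k ∈ S then -1 else -1) (by intro i; split_ifs <;> norm_num)
    have : ∑ k ∈ S, ((Eᴴ * blk W 0 1 * F) k k).re =
        ∑ k, if k ∈ S then ((Eᴴ * blk W 0 1 * F) k k).re else 0 := by simp
    have e : ∑ k, (if k ∈ S then -1 else 1) * ((Eᴴ * blk W 0 1 * F) k k).re +
      ∑ k, (if k ∈ S then -1 else -1) * ((Eᴴ * blk W 0 1 * F) k k).re =
       -2 * ∑ k ∈ S, ((Eᴴ * blk W 0 1 * F) k k).re := by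
      rw [this, ← Finset.sum_add_distrib, Finset.mul_sum]
      refine Finset.sum_congr rfl fun k _ => ?_
      split_ifs <;> ring
    linarith
  have dg : ∀ (i : Fin 2) (D : Fin n → ℝ) (G : Matrix (Fin n) (Fin n) ℂ), G * Gᴴ = 1 →
      (∀ k, D k ^ 2 ≤ m) → ∑ k, D k * D k * ((Gᴴ * blk W i i * G) k k).re ≤
        m * (blk W i i).trace.re := by
    intro i D G hG hD
    have : (blk W i i).trace = (Gᴴ * blk W i i * G).trace := by
      rw [Matrix.trace_mul_cycle, hG, Matrix.one_mul]
    rw [this, Matrix.trace, Complex.re_sum, Finset.mul_sum]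
    refine Finset.sum_le_sum fun k _ => ?_
    rw [← sq]
    exact mul_le_mul_of_nonneg_right (hD k) (bp_diag hW i G k)
  rw [tr, tr, tr]
  have d0 := dg 0 d E hE' hdm
  have d1 := dg 1 d' F hF' hdm'
  have hx : ∑ k, d k * d' k * ((Eᴴ * blk W 0 1 * F) k k).re =
      p * ∑ k ∈ S, ((Eᴴ * blk W 0 1 * F) k k).re := by
    simp only [hp, ite_mul, zero_mul, Finset.sum_ite_mem, Finset.univ_inter, Finset.mul_sum]
  rw [hx]
  have htr : W.trace.re = (blk W 0 0).trace.re + (blk W 1 1).trace.re := by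
    rw [trace_blk, Complex.add_re]
  have htr0 : 0 ≤ W.trace.re := by
    rw [htr]
    have a0 : 0 ≤ (blk W 0 0).trace.re := by
      rw [Matrix.trace, Complex.re_sum]
      exact Finset.sum_nonneg fun k _ => by simpa using bp_diag hW 0 1 k
    have a1 : 0 ≤ (blk W 1 1).trace.re := by
      rw [Matrix.trace, Complex.re_sum]
      exact Finset.sum_nonneg fun k _ => by simpa using bp_diag hW 1 1 k
    linarith
  have k1 := mul_le_mul_of_nonneg_left hs hp0
  have k2 := mul_le_mul_of_nonneg_right hpc htr0
  have k3 : m * W.trace.re = m * (blk W 0 0).trace.re + m * (blk W 1 1).trace.re := by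
    rw [htr]; ring
  linarith

lemma scalar_ineq (s : ℝ) (h0 : 0 ≤ s) (h1 : s ≤ 1) :
    √s * √(1 - s) ≤ (1 + √2) / 2 - max s (1 - s) := by
  have h2 : √2 ^ 2 = 2 := Real.sq_sqrt (by norm_num)
  have h3 : 1 ≤ √2 := Real.one_le_sqrt.mpr (by norm_num)
  have hm : max s (1 - s) ≤ 1 := max_le h1 (by linarith)
  have hp : (√s * √(1 - s)) ^ 2 = s * (1 - s) := by
    rw [mul_pow, Real.sq_sqrt h0, Real.sq_sqrt (by linarith)]
  refine (sq_le_sq₀ (by positivity) (by linarith)).mp ?_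
  rw [hp]
  rcases max_cases s (1 - s) with ⟨h, _⟩ | ⟨h, _⟩ <;> rw [h]
  · nlinarith [sq_nonneg (s - (2 + √2) / 4)]
  · nlinarith [sq_nonneg ((1 - s) - (2 + √2) / 4)]

lemma diag_case {n : ℕ} (hn : 2 ≤ n) {W : Matrix (Fin 2 × Fin n) (Fin 2 × Fin n) ℂ}
    (hW : BlockPositive W) (A B : Matrix (Fin n) (Fin 2) ℂ) (s : ℝ) (h0 : 0 ≤ s) (h1 : s ≤ 1)
    (hA : Aᴴ * A = Matrix.diagonal fun i => ((![s, 1 - s] i : ℝ) : ℂ))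
    (hB : Bᴴ * B = Matrix.diagonal fun i => ((![1 - s, s] i : ℝ) : ℂ)) :
    (Aᴴ * blk W 0 0 * A).trace.re + (Bᴴ * blk W 1 1 * B).trace.re
      + 2 * (Aᴴ * blk W 0 1 * B).trace.re ≤ (1 + √2) / 2 * W.trace.re := by
  let R : Matrix (Fin 2) (Fin n) ℂ := Matrix.of fun i j => if i.val = j.val then 1 else 0
  let i0 : Fin n := ⟨0, by omega⟩
  let i1 : Fin n := ⟨1, by omega⟩
  have hR : R * Rᴴ = 1 := by
    ext i j
    have hlt : i.val < n := lt_of_lt_of_le i.2 hn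
    rw [Matrix.mul_apply, Finset.sum_eq_single (⟨i.val, hlt⟩ : Fin n)]
    · simp [R, Matrix.one_apply, Fin.ext_iff, eq_comm]
    · intro b _ hb
      have : ¬ i.val = b.val := fun h => hb (Fin.ext h.symm)
      simp [R, this]
    · simp
  have htr : ∀ (P Q : Matrix (Fin n) (Fin 2) ℂ) (Y : Matrix (Fin n) (Fin n) ℂ),
      ((P * R)ᴴ * Y * (Q * R)).trace = (Pᴴ * Y * Q).trace := by
    intro P Q Y
    rw [Matrix.conjTranspose_mul, ← Matrix.mul_assoc, Matrix.trace_mul_comm]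
    simp only [← Matrix.mul_assoc]
    rw [hR, Matrix.one_mul]
  have hpad : ∀ (P : Matrix (Fin n) (Fin 2) ℂ) (x y : ℝ), 0 ≤ x → 0 ≤ y →
      Pᴴ * P = Matrix.diagonal (fun i => ((![x, y] i : ℝ) : ℂ)) →
      (P * R)ᴴ * (P * R) = Matrix.diagonal fun i : Fin n =>
        (((if i = i0 then √x else if i = i1 then √y else 0) ^ 2 : ℝ) : ℂ) := by
    intro P x y hx hy h
    have : (P * R)ᴴ * (P * R) = Rᴴ * (Pᴴ * P) * R := by
      simp [Matrix.conjTranspose_mul, Matrix.mul_assoc]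
    rw [this, h]
    ext i j
    rw [Matrix.mul_apply, Fin.sum_univ_two, Matrix.mul_diagonal, Matrix.mul_diagonal,
      Matrix.diagonal_apply]
    have hx' : ((√x : ℝ) : ℂ) ^ 2 = x := by exact_mod_cast Real.sq_sqrt hx
    have hy' : ((√y : ℝ) : ℂ) ^ 2 = y := by exact_mod_cast Real.sq_sqrt hy
    simp only [R, Matrix.conjTranspose_apply, Matrix.of_apply, i0, i1, Fin.ext_iff]
    have e0 : (0 : ℕ) = i.val ↔ i.val = 0 := eq_comm
    have e1 : (1 : ℕ) = i.val ↔ i.val = 1 := eq_comm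
    have e2 : (0 : ℕ) = j.val ↔ j.val = 0 := eq_comm
    have e3 : (1 : ℕ) = j.val ↔ j.val = 1 := eq_comm
    simp only [Fin.val_zero, Fin.val_one, e0, e1, e2, e3]
    split_ifs <;> first | omega | simp [hx', hy']
  have hi : i1 ≠ i0 := by simp [i0, i1]
  have hs' : 0 ≤ 1 - s := by linarith
  have key := core_ineq hW (A * R) (B * R)
    (fun i => if i = i0 then √s else if i = i1 then √(1 - s) else 0)
    (fun i => if i = i0 then √(1 - s) else if i = i1 then √s else 0)
    (fun i => by split_ifs <;> positivity) (fun i => by split_ifs <;> positivity)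
    (hpad A s (1 - s) h0 hs' hA) (hpad B (1 - s) s hs' h0 hB)
    (max s (1 - s)) (√s * √(1 - s)) ((1 + √2) / 2) {i0, i1}
    (fun i => by
      split_ifs
      · rw [Real.sq_sqrt h0]; exact le_max_left _ _
      · rw [Real.sq_sqrt hs']; exact le_max_right _ _
      · have := le_max_left s (1 - s)
        simp; tauto)
    (fun i => by
      split_ifs
      · rw [Real.sq_sqrt hs']; exact le_max_right _ _
      · rw [Real.sq_sqrt h0]; exact le_max_left _ _
      · simp; tauto)
    (fun i => by
      by_cases h : i = i0
      · simp [h]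
      · by_cases h' : i = i1
        · simp [h', hi, mul_comm]
        · simp [h, h'])
    (by positivity) (scalar_ineq s h0 h1)
  rwa [htr, htr, htr] at key

lemma balanced_case {n : ℕ} (hn : 2 ≤ n) {W : Matrix (Fin 2 × Fin n) (Fin 2 × Fin n) ℂ}
    (hW : BlockPositive W) (A B : Matrix (Fin n) (Fin 2) ℂ)
    (hAB : Aᴴ * A + Bᴴ * B = 1) (ht : (Aᴴ * A).trace = 1) :
    (Aᴴ * blk W 0 0 * A).trace.re + (Bᴴ * blk W 1 1 * B).trace.re
      + 2 * (Aᴴ * blk W 0 1 * B).trace.re ≤ (1 + √2) / 2 * W.trace.re := by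
  have hP := Matrix.posSemidef_conjTranspose_mul_self A
  have hPB := Matrix.posSemidef_conjTranspose_mul_self B
  let V : Matrix (Fin 2) (Fin 2) ℂ := hP.1.eigenvectorUnitary
  have hV : Vᴴ * V = 1 := Unitary.coe_star_mul_self hP.1.eigenvectorUnitary
  have hV' : V * Vᴴ = 1 := mul_eq_one_comm.mp hV
  have hsum : hP.1.eigenvalues 0 + hP.1.eigenvalues 1 = 1 := by
    have := hP.1.trace_eq_sum_eigenvalues
    rw [ht, Fin.sum_univ_two] at this
    apply Complex.ofReal_injective
    simpa using this.symm
  have g0 := hP.eigenvalues_nonneg 0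
  have g1 := hP.eigenvalues_nonneg 1
  have hd : Vᴴ * (Aᴴ * A) * V = Matrix.diagonal fun i => ((hP.1.eigenvalues i : ℝ) : ℂ) := by
    have := hP.1.spectral_theorem
    rw [Unitary.conjStarAlgAut_apply] at this
    conv_lhs => rw [this]
    change Vᴴ * (V * _ * Vᴴ) * V = _
    rw [Matrix.mul_assoc, Matrix.mul_assoc, Matrix.mul_assoc, hV, Matrix.mul_one,
      ← Matrix.mul_assoc, hV, Matrix.one_mul]
    rfl
  have htr : ∀ (P Q : Matrix (Fin n) (Fin 2) ℂ) (Y : Matrix (Fin n) (Fin n) ℂ),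
      ((P * V)ᴴ * Y * (Q * V)).trace = (Pᴴ * Y * Q).trace := by
    intro P Q Y
    rw [Matrix.conjTranspose_mul, ← Matrix.mul_assoc, Matrix.trace_mul_comm]
    simp only [← Matrix.mul_assoc]
    rw [hV', Matrix.one_mul]
  have hdA : (A * V)ᴴ * (A * V) = Matrix.diagonal fun i => ((hP.1.eigenvalues i : ℝ) : ℂ) := by
    rw [← hd]; simp [Matrix.mul_assoc]
  have hdB : (B * V)ᴴ * (B * V) =
      Matrix.diagonal fun i => ((1 - hP.1.eigenvalues i : ℝ) : ℂ) := by
    have : (B * V)ᴴ * (B * V) = Vᴴ * V - (A * V)ᴴ * (A * V) := by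
      have : Bᴴ * B = 1 - Aᴴ * A := by rw [← hAB]; abel
      calc (B * V)ᴴ * (B * V) = Vᴴ * (Bᴴ * B) * V := by simp [Matrix.mul_assoc]
        _ = _ := by
          rw [this]; simp [Matrix.mul_assoc, Matrix.mul_sub, Matrix.sub_mul]
    rw [this, hdA, hV, ← Matrix.diagonal_one, Matrix.diagonal_sub]
    congr 1; ext i; simp
  have key := diag_case hn hW (A * V) (B * V) (hP.1.eigenvalues 0) g0 (by linarith)
    (by
      rw [hdA]; congr 1; ext i
      fin_cases i
      · simp
      · simp [← hsum])
    (by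
      rw [hdB]; congr 1; ext i
      fin_cases i
      · simp
      · simp [← hsum])
  rwa [htr, htr, htr] at key

lemma exists_phase (z : ℂ) : ∃ w : ℂ, star w * w = 1 ∧ (w * z).re = 0 := by
  by_cases hz : z = 0
  · exact ⟨1, by simp, by simp [hz]⟩
  · have hn : (‖z‖ : ℂ) ≠ 0 := by exact_mod_cast norm_ne_zero_iff.mpr hz
    have hc : (starRingEnd ℂ) z * z = (‖z‖ : ℂ) ^ 2 := Complex.conj_mul' z
    refine ⟨Complex.I * star z / ‖z‖, ?_, ?_⟩
    · simp
      field_simp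
      rw [Complex.I_sq]
      linear_combination hc
    · have : Complex.I * star z / ‖z‖ * z = (‖z‖ : ℂ) * Complex.I := by
        field_simp
        rw [Complex.star_def, hc]
      rw [this]; simp

lemma main_bound {n : ℕ} (hn : 2 ≤ n) {W : Matrix (Fin 2 × Fin n) (Fin 2 × Fin n) ℂ}
    (hW : BlockPositive W) (M : Matrix (Fin 2 × Fin n) (Fin 2) ℂ) (hM : Mᴴ * M = 1) :
    (Mᴴ * W * M).trace.re ≤ (1 + √2) / 2 * W.trace.re := by
  let A : Matrix (Fin n) (Fin 2) ℂ := Matrix.of fun k j => M (0, k) j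
  let B : Matrix (Fin n) (Fin 2) ℂ := Matrix.of fun k j => M (1, k) j
  obtain ⟨w, hw1, hw2⟩ := exists_phase (Aᴴ * B).trace
  let r : ℂ := ((√2)⁻¹ : ℝ)
  have hr : r * r = 1 / 2 := by
    have : (√2)⁻¹ * (√2)⁻¹ = (1 / 2 : ℝ) := by
      rw [← mul_inv, Real.mul_self_sqrt (by norm_num)]; norm_num
    simp only [r]; rw [← Complex.ofReal_mul, this]; simp
  have hrs : star r = r := by simp [r]
  let U : Matrix (Fin 2) (Fin 2) ℂ := !![r, r; r * star w, - (r * star w)]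
  have hU : U * Uᴴ = 1 := by
    ext i j
    have hw1' : w * star w = 1 := by rw [mul_comm]; exact hw1
    rw [Matrix.mul_apply, Fin.sum_univ_two]
    simp only [Matrix.conjTranspose_apply]
    fin_cases i <;> fin_cases j <;>
      simp [U, -Complex.star_def, hrs]
    · linear_combination 2 * hr
    · rw [Complex.star_def] at hw1
      linear_combination (2 * hw1) * (r * r) + 2 * hr
  have hU' : Uᴴ * U = 1 := mul_eq_one_comm.mp hU
  let K : Matrix (Fin 2 × Fin n) (Fin 2 × Fin n) ℂ := Matrix.kronecker U 1
  have hK : K * Kᴴ = 1 := by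
    simp only [K, Matrix.kronecker, Matrix.conjTranspose_kronecker, ← Matrix.mul_kronecker_mul, hU]
    simp
  have hKv : ∀ (a : Fin 2 → ℂ) (b : Fin n → ℂ), K *ᵥ prodVec a b = prodVec (U *ᵥ a) b := by
    intro a b
    ext ⟨i, k⟩
    simp [K, Matrix.mulVec, dotProduct, prodVec, Fintype.sum_prod_type, Matrix.kroneckerMap_apply,
      Matrix.one_apply]
    ring
  have hW' : BlockPositive (Kᴴ * W * K) := by
    refine ⟨Matrix.isHermitian_conjTranspose_mul_mul K hW.1, fun a b => ?_⟩
    have : star (prodVec a b) ⬝ᵥ (Kᴴ * W * K) *ᵥ (prodVec a b) =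
        star (prodVec (U *ᵥ a) b) ⬝ᵥ W *ᵥ (prodVec (U *ᵥ a) b) := by
      rw [← hKv, Matrix.star_mulVec, ← Matrix.dotProduct_mulVec, Matrix.mulVec_mulVec,
        Matrix.mulVec_mulVec, Matrix.mul_assoc]
    rw [this]
    exact hW.2 _ _
  have hKM : (Kᴴ * M)ᴴ * (Kᴴ * W * K) * (Kᴴ * M) = Mᴴ * W * M := by
    rw [Matrix.conjTranspose_mul, Matrix.conjTranspose_conjTranspose]
    calc Mᴴ * K * (Kᴴ * W * K) * (Kᴴ * M) = Mᴴ * (K * Kᴴ) * W * (K * Kᴴ) * M := by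
          simp only [Matrix.mul_assoc]
      _ = _ := by simp [hK]
  have hKW : (Kᴴ * W * K).trace = W.trace := by
    rw [Matrix.trace_mul_cycle, hK, Matrix.one_mul]
  let A1 : Matrix (Fin n) (Fin 2) ℂ := r • (A + w • B)
  let B1 : Matrix (Fin n) (Fin 2) ℂ := r • (A - w • B)
  have hA1 : ∀ k j, (Kᴴ * M) (0, k) j = A1 k j := by
    intro k j
    simp [K, Matrix.mul_apply, Fintype.sum_prod_type, Matrix.kroneckerMap_apply,
      Matrix.one_apply, U, A1, A, B, r, apply_ite (starRingEnd ℂ), ite_mul]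
    ring
  have hB1 : ∀ k j, (Kᴴ * M) (1, k) j = B1 k j := by
    intro k j
    simp [K, Matrix.mul_apply, Fintype.sum_prod_type, Matrix.kroneckerMap_apply,
      Matrix.one_apply, U, B1, A, B, r, apply_ite (starRingEnd ℂ), ite_mul]
    ring
  have hAB : Aᴴ * A + Bᴴ * B = 1 := by
    rw [← hM]; ext i j
    simp [Matrix.mul_apply, Fintype.sum_prod_type, A, B]
  have hA1A1 : A1ᴴ * A1 = (1 / 2 : ℂ) • (Aᴴ * A + w • (Aᴴ * B) + star w • (Bᴴ * A) + Bᴴ * B) := by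
    have c1 : r * star (r * w) = 1 / 2 * star w := by
      rw [star_mul', hrs]; linear_combination star w * hr
    have c2 : r * w * r = 1 / 2 * w := by linear_combination w * hr
    have c3 : r * w * star (r * w) = 1 / 2 := by
      rw [star_mul', hrs]; linear_combination hw1 * (r * r) + hr
    simp only [A1, Matrix.conjTranspose_smul, Matrix.conjTranspose_add, Matrix.smul_mul,
      Matrix.mul_smul, smul_smul, hrs, hr, Matrix.add_mul, Matrix.mul_add, smul_add, c1, c2, c3]
    abel
  have hB1B1 : B1ᴴ * B1 = (1 / 2 : ℂ) • (Aᴴ * A - w • (Aᴴ * B) - star w • (Bᴴ * A) + Bᴴ * B) := by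
    have c1 : r * star (r * w) = 1 / 2 * star w := by
      rw [star_mul', hrs]; linear_combination star w * hr
    have c2 : r * w * r = 1 / 2 * w := by linear_combination w * hr
    have c3 : r * w * star (r * w) = 1 / 2 := by
      rw [star_mul', hrs]; linear_combination hw1 * (r * r) + hr
    simp only [B1, Matrix.conjTranspose_smul, Matrix.conjTranspose_sub, Matrix.smul_mul,
      Matrix.mul_smul, smul_smul, hrs, hr, Matrix.sub_mul, Matrix.mul_sub, smul_sub,
      smul_add, c1, c2, c3]
    abel
  have hsum : A1ᴴ * A1 + B1ᴴ * B1 = 1 := by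
    rw [hA1A1, hB1B1, ← hAB, ← smul_add]
    ext i j
    simp
    ring
  have ht : (A1ᴴ * A1).trace = 1 := by
    have e1 : (Bᴴ * A).trace = star (Aᴴ * B).trace := by
      rw [← Matrix.trace_conjTranspose]; simp
    have e2 : (Aᴴ * A).trace + (Bᴴ * B).trace = 2 := by
      rw [← Matrix.trace_add, hAB]; simp
    have e3 : w * (Aᴴ * B).trace + star w * star (Aᴴ * B).trace = 0 := by
      have := Complex.add_conj (w * (Aᴴ * B).trace)
      rw [hw2] at this
      simpa using this
    rw [hA1A1]
    simp only [Matrix.trace_smul, Matrix.trace_add, e1, smul_eq_mul]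
    linear_combination (1 / 2) * e2 + (1 / 2) * e3
  have key := balanced_case hn hW' A1 B1 hsum ht
  rw [hKW] at key
  rw [← hKM, form_blk _ _ A1 B1 hA1 hB1]
  have e3 : (B1ᴴ * blk (Kᴴ * W * K) 1 0 * A1).trace =
      star (A1ᴴ * blk (Kᴴ * W * K) 0 1 * B1).trace := by
    rw [← Matrix.trace_conjTranspose, ← blk_conj hW'.1 0 1]
    simp [Matrix.mul_assoc]
  simp only [Matrix.trace_add, e3, Complex.add_re, Complex.star_def, Complex.conj_re]
  linarith

lemma pair_bound {n : ℕ} (hn : 2 ≤ n) {W : Matrix (Fin 2 × Fin n) (Fin 2 × Fin n) ℂ}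
    (hW : BlockPositive W) (i j : Fin 2 × Fin n) (hij : i ≠ j) :
    hW.1.eigenvalues i + hW.1.eigenvalues j ≤ (1 + √2) / 2 * W.trace.re := by
  let V : Matrix (Fin 2 × Fin n) (Fin 2 × Fin n) ℂ := hW.1.eigenvectorUnitary
  have hV : Vᴴ * V = 1 := Unitary.coe_star_mul_self hW.1.eigenvectorUnitary
  have hd : Vᴴ * W * V = Matrix.diagonal fun i => ((hW.1.eigenvalues i : ℝ) : ℂ) := by
    have := hW.1.spectral_theorem
    rw [Unitary.conjStarAlgAut_apply] at this
    conv_lhs => rw [this]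
    change Vᴴ * (V * _ * Vᴴ) * V = _
    rw [Matrix.mul_assoc, Matrix.mul_assoc, Matrix.mul_assoc, hV, Matrix.mul_one,
      ← Matrix.mul_assoc, hV, Matrix.one_mul]
    rfl
  let f : Fin 2 → Fin 2 × Fin n := ![i, j]
  have hf : Function.Injective f := by
    intro a b
    fin_cases a <;> fin_cases b <;> simp [f, hij, hij.symm]
  let M : Matrix (Fin 2 × Fin n) (Fin 2) ℂ := V.submatrix id f
  have hM : Mᴴ * M = 1 := by
    have : Mᴴ * M = (Vᴴ * V).submatrix f f := rfl
    rw [this, hV, Matrix.submatrix_one f hf]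
  have hMW : Mᴴ * W * M = (Vᴴ * W * V).submatrix f f := rfl
  have key := main_bound hn hW M hM
  rw [hMW, hd, Matrix.trace, Fin.sum_univ_two] at key
  simp only [Matrix.diag_apply, Matrix.submatrix_apply, Matrix.diagonal_apply_eq,
    Complex.add_re, Complex.ofReal_re] at key
  exact key

/-- For a normalized `2 × n` entanglement witness with eigenvalues listed in
non-increasing order, `∑_{i=3}^{2n} λ_i ≥ -1/(2 + 2√2)`. -/
theorem stmt_7 {n : ℕ} (hn : 2 ≤ n)
    (W : Matrix (Fin 2 × Fin n) (Fin 2 × Fin n) ℂ)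
    (hBP : BlockPositive W) (hNP : ¬ W.PosSemidef) (htr : W.trace = 1) :
    -(1 / (2 + 2 * Real.sqrt 2)) ≤ ((sortedEigs hBP.1).drop 2).sum := by
  have hsum : (sortedEigs hBP.1).sum = 1 := by
    have h1 : (sortedEigs hBP.1).sum = ∑ i, hBP.1.eigenvalues i := by
      rw [← Multiset.sum_coe, sortedEigs, Multiset.sort_eq]
      rfl
    have h2 := hBP.1.trace_eq_sum_eigenvalues
    rw [htr] at h2
    rw [h1]
    apply Complex.ofReal_injective
    simpa using h2.symm
  have hms : ((sortedEigs hBP.1 : List ℝ) : Multiset ℝ) =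
      Finset.univ.val.map hBP.1.eigenvalues := by
    rw [sortedEigs, Multiset.sort_eq]
  have hlen : (sortedEigs hBP.1).length = 2 * n := by
    rw [← Multiset.coe_card, hms]; simp
  have hc : 1 / (2 + 2 * √2) = (√2 - 1) / 2 := by
    have h2 : √2 ^ 2 = 2 := Real.sq_sqrt (by norm_num)
    have h3 : 0 ≤ √2 := Real.sqrt_nonneg 2
    rw [div_eq_div_iff (by positivity) (by norm_num)]
    nlinarith
  generalize sortedEigs hBP.1 = l at *
  match l, hlen with
  | [], h => simp at h; omega
  | [x], h => simp at h; omega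
  | x :: y :: t, _ =>
    simp only [List.drop_succ_cons, List.drop_zero, List.sum_cons] at hsum ⊢
    have hx : ∃ i, hBP.1.eigenvalues i = x := by
      have : x ∈ Finset.univ.val.map hBP.1.eigenvalues := by rw [← hms]; simp
      simpa using this
    obtain ⟨i, hi⟩ := hx
    have herase : ((y :: t : List ℝ) : Multiset ℝ) =
        (Finset.univ.erase i).val.map hBP.1.eigenvalues := by
      have h1 : (Finset.univ : Finset (Fin 2 × Fin n)).val =
          i ::ₘ (Finset.univ.erase i).val := by
        rw [Finset.erase_val, Multiset.cons_erase (Finset.mem_univ i)]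
      rw [h1, Multiset.map_cons, hi, ← Multiset.cons_coe] at hms
      exact (Multiset.cons_inj_right x).mp hms
    have hy : y ∈ (Finset.univ.erase i).val.map hBP.1.eigenvalues := by rw [← herase]; simp
    obtain ⟨j, hj, hjy⟩ := Multiset.mem_map.mp hy
    have hij : i ≠ j := fun h => Finset.ne_of_mem_erase (Finset.mem_val.mp hj) h.symm
    have := pair_bound hn hBP i j hij
    rw [htr, hi, hjy] at this
    simp only [Complex.one_re, mul_one] at this
    rw [hc]
    linarith

end
end

section
/- Let m ≥ 2 and let W be a normalized m×m entanglement witness. Then the negativity satisfies N(W) ≤ (m − 1)/2. Moreover, if N(W) = (m − 1)/2, then the eigenvalues of W (with multiplicity) are exactly 1/m with multiplicity m(m+1)/2 and −1/m with multiplicity m(m−1)/2. -/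
open Matrix ComplexOrder

noncomputable section

/-- A phase vector indexed by `x : Fin m → ZMod 3`. -/
def phaseVec {m : ℕ} (x : Fin m → ZMod 3) : Fin m → ℂ := fun k => ZMod.stdAddChar (x k)

/-- exponent homomorphism -/
def expHom {m : ℕ} (k l p q : Fin m) : (Fin m → ZMod 3) →+ ZMod 3 where
  toFun x := -x k + x l - x p + x q
  map_zero' := by simp
  map_add' x y := by simp only [Pi.add_apply]; ring

lemma expHom_zero_iff {m : ℕ} (k l p q : Fin m) :
    (∀ x, expHom k l p q x = 0) ↔ ((k = l ∧ p = q) ∨ (k = q ∧ l = p)) := by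
  constructor
  · intro h
    have h1 := h (Pi.single k 1)
    have h2 := h (Pi.single l 1)
    have h3 := h (Pi.single p 1)
    have h4 := h (Pi.single q 1)
    simp only [expHom, AddMonoidHom.coe_mk, ZeroHom.coe_mk, Pi.single_apply, if_true] at h1 h2 h3 h4
    have c1 : (1 : ZMod 3) ≠ 0 := by decide
    have c2 : (-1 : ZMod 3) ≠ 0 := by decide
    have c3 : (-1 - 1 : ZMod 3) ≠ 0 := by decide
    by_cases a1 : k = l
    · subst a1
      refine Or.inl ⟨rfl, ?_⟩
      by_contra a2
      rw [if_neg (Ne.symm a2)] at h3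
      exact c2 (by linear_combination h3)
    · rw [if_neg (Ne.symm a1)] at h1
      have a3 : k = q := by
        by_contra a3
        rw [if_neg (Ne.symm a3)] at h1
        split_ifs at h1
        · exact c3 (by linear_combination h1)
        · exact c2 (by linear_combination h1)
      subst a3
      refine Or.inr ⟨rfl, ?_⟩
      by_contra a4
      rw [if_neg a1, if_neg (Ne.symm a4)] at h2
      exact c1 (by linear_combination h2)
  · rintro (⟨rfl, rfl⟩ | ⟨rfl, rfl⟩) x <;> simp [expHom]

lemma phase_sum {m : ℕ} (k l p q : Fin m) :
    ∑ x : Fin m → ZMod 3, (star (phaseVec x k) * phaseVec x l * star (phaseVec x p) * phaseVec x q)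
      = (Fintype.card (Fin m → ZMod 3) : ℂ) *
        (((if k = l then if p = q then 1 else 0 else 0)
          + (if k = q then if l = p then 1 else 0 else 0))
          - (if k = l then if p = q then if k = q then 1 else 0 else 0 else 0)) := by
  classical
  have h1 : ∀ x : Fin m → ZMod 3,
      (star (phaseVec x k) * phaseVec x l * star (phaseVec x p) * phaseVec x q)
      = ((ZMod.stdAddChar (N := 3)).compAddMonoidHom (expHom k l p q)) x := by
    intro x
    simp only [phaseVec, AddChar.compAddMonoidHom_apply, expHom, AddMonoidHom.coe_mk,
      ZeroHom.coe_mk, AddChar.map_add_eq_mul, sub_eq_add_neg, AddChar.map_neg_eq_conj]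
    simp
  rw [Finset.sum_congr rfl fun x _ => h1 x, AddChar.sum_eq_ite]
  have h2 : ((ZMod.stdAddChar (N := 3)).compAddMonoidHom (expHom k l p q) = 0) ↔
      ((k = l ∧ p = q) ∨ (k = q ∧ l = p)) := by
    rw [← expHom_zero_iff]
    constructor
    · intro h x
      have := DFunLike.congr_fun h x
      rw [AddChar.compAddMonoidHom_apply, AddChar.zero_apply,
        ← AddChar.map_zero_eq_one (ZMod.stdAddChar (N := 3))] at this
      exact ZMod.injective_stdAddChar this
    · intro h
      ext x
      simp [h x]
  simp only [h2]
  by_cases a1 : k = l <;> by_cases a2 : p = q <;> by_cases a3 : k = q <;> by_cases a4 : l = p <;>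
    simp_all

/-- quartic form -/
def quart {m : ℕ} (T : Fin m → Fin m → Fin m → Fin m → ℂ) (b : Fin m → ℂ) : ℂ :=
  ∑ k, ∑ l, ∑ p, ∑ q, (star (b k) * b l * star (b p) * b q) * T k l p q

lemma nonneg_of_ofReal_mul {r : ℝ} (hr : 0 < r) {z : ℂ} (h : 0 ≤ (r : ℂ) * z) : 0 ≤ z := by
  rw [Complex.nonneg_iff] at h ⊢
  simp only [Complex.re_ofReal_mul, Complex.im_ofReal_mul] at h
  refine ⟨nonneg_of_mul_nonneg_right h.1 hr, ?_⟩
  rcases mul_eq_zero.1 h.2.symm with hz | hz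
  · exact absurd hz hr.ne'
  · exact hz.symm

lemma design {m : ℕ} (T : Fin m → Fin m → Fin m → Fin m → ℂ) (h : ∀ b, 0 ≤ quart T b) :
    0 ≤ ∑ k, ∑ p, T k k p p + ∑ k, ∑ l, T k l l k := by
  have hb : ∀ k, quart T (Pi.single k 1) = T k k k k := by
    intro k
    simp [quart, Pi.single_apply]
  have hs : ∑ x : Fin m → ZMod 3, quart T (phaseVec x) =
      (Fintype.card (Fin m → ZMod 3) : ℂ) *
        (∑ k, ∑ p, T k k p p + ∑ k, ∑ l, T k l l k - ∑ k, T k k k k) := by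
    have : ∑ x : Fin m → ZMod 3, quart T (phaseVec x) = ∑ k, ∑ l, ∑ p, ∑ q,
        (∑ x : Fin m → ZMod 3,
          (star (phaseVec x k) * phaseVec x l * star (phaseVec x p) * phaseVec x q)) * T k l p q := by
      simp only [quart, Finset.sum_mul]
      rw [Finset.sum_comm]; refine Finset.sum_congr rfl fun k _ => ?_
      rw [Finset.sum_comm]; refine Finset.sum_congr rfl fun l _ => ?_
      rw [Finset.sum_comm]; refine Finset.sum_congr rfl fun p _ => ?_
      rw [Finset.sum_comm]
    rw [this]
    simp only [phase_sum]
    simp only [mul_assoc, ← Finset.mul_sum]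
    congr 1
    simp only [sub_mul, add_mul, ite_mul, one_mul, zero_mul, Finset.sum_sub_distrib,
      Finset.sum_add_distrib]
    simp
  have h1 : 0 ≤ ∑ x : Fin m → ZMod 3, quart T (phaseVec x) := Finset.sum_nonneg fun x _ => h _
  have h2 : 0 ≤ ∑ k, T k k k k := Finset.sum_nonneg fun k _ => by rw [← hb]; exact h _
  rw [hs] at h1
  have hc : (0 : ℝ) < (Fintype.card (Fin m → ZMod 3) : ℝ) := by
    exact_mod_cast Fintype.card_pos
  have h3 := nonneg_of_ofReal_mul hc (by rw [Complex.ofReal_natCast]; exact h1)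
  have := add_nonneg h3 h2
  simpa using this

lemma psd_minor {n : Type*} [Fintype n] {M : Matrix n n ℂ} (hM : M.PosSemidef) (i j : n) :
    0 ≤ M i i * M j j - M i j * M j i := by
  have := (hM.submatrix ![i, j]).det_nonneg
  rw [Matrix.det_fin_two] at this
  simpa using this

/-- contraction of `W` with `b` on the second factor -/
def contr {m : ℕ} (W : Matrix (Fin m × Fin m) (Fin m × Fin m) ℂ) (b : Fin m → ℂ) :
    Matrix (Fin m) (Fin m) ℂ :=
  fun i j => ∑ k, ∑ l, star (b k) * b l * W (i, k) (j, l)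

lemma contr_psd {m : ℕ} {W : Matrix (Fin m × Fin m) (Fin m × Fin m) ℂ}
    (hBP : BlockPositive W) (b : Fin m → ℂ) : (contr W b).PosSemidef := by
  refine .of_dotProduct_mulVec_nonneg ?_ fun a => ?_
  · ext i j
    simp only [conjTranspose_apply, contr, star_sum, star_mul', star_star]
    rw [Finset.sum_comm]
    refine Finset.sum_congr rfl fun k _ => Finset.sum_congr rfl fun l _ => ?_
    rw [← hBP.1.apply (i, k) (j, l)]; ring
  · have h := hBP.2 a b
    have e : star a ⬝ᵥ (contr W b) *ᵥ a = star (prodVec a b) ⬝ᵥ W.mulVec (prodVec a b) := by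
      simp only [dotProduct, mulVec, contr, prodVec, Fintype.sum_prod_type, Finset.mul_sum,
        Finset.sum_mul, Pi.star_apply, star_mul']
      refine Finset.sum_congr rfl fun i _ => ?_
      rw [Finset.sum_comm]; refine Finset.sum_congr rfl fun k _ => ?_
      refine Finset.sum_congr rfl fun j _ => Finset.sum_congr rfl fun l _ => ?_
      ring
    rw [e, Complex.nonneg_iff]
    exact ⟨h.1, h.2.symm⟩

lemma sum4_comm {m : ℕ} (F : Fin m → Fin m → Fin m → Fin m → ℂ) :
    ∑ k, ∑ l, ∑ i, ∑ j, F k l i j = ∑ i, ∑ j, ∑ k, ∑ l, F k l i j := by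
  have h1 : ∀ k, ∑ l, ∑ i, ∑ j, F k l i j = ∑ i, ∑ j, ∑ l, F k l i j := fun k => by
    rw [Finset.sum_comm]
    exact Finset.sum_congr rfl fun i _ => Finset.sum_comm
  rw [Finset.sum_congr rfl fun k _ => h1 k, Finset.sum_comm]
  exact Finset.sum_congr rfl fun i _ => Finset.sum_comm

lemma contr_mul {m : ℕ} (W : Matrix (Fin m × Fin m) (Fin m × Fin m) ℂ) (b : Fin m → ℂ)
    (i j i2 j2 : Fin m) : contr W b i j * contr W b i2 j2 = ∑ k, ∑ l, ∑ p, ∑ q,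
      (star (b k) * b l * star (b p) * b q) * (W (i, k) (j, l) * W (i2, p) (j2, q)) := by
  simp only [contr, Finset.sum_mul]
  simp only [Finset.mul_sum]
  refine Finset.sum_congr rfl fun k _ => Finset.sum_congr rfl fun l _ =>
    Finset.sum_congr rfl fun p _ => Finset.sum_congr rfl fun q _ => ?_
  ring

lemma one_side {m : ℕ} {W : Matrix (Fin m × Fin m) (Fin m × Fin m) ℂ}
    (hBP : BlockPositive W) :
    0 ≤ (W.trace ^ 2 - ∑ i, ∑ j, (∑ k, W (i, k) (j, k)) * (∑ k, W (j, k) (i, k)))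
      + ((∑ k, ∑ l, (∑ i, W (i, k) (i, l)) * (∑ i, W (i, l) (i, k))) - (W * W).trace) := by
  have h := design (fun k l p q => ∑ i, ∑ j,
    (W (i, k) (i, l) * W (j, p) (j, q) - W (i, k) (j, l) * W (j, p) (i, q))) ?_
  · simp only [Finset.sum_sub_distrib] at h
    have A : ∑ k, ∑ p, ∑ i, ∑ j, W (i, k) (i, k) * W (j, p) (j, p) = W.trace ^ 2 := by
      simp only [← Finset.mul_sum, ← Finset.sum_mul]
      simp only [trace, diag, Fintype.sum_prod_type_right, sq]
    have B : ∑ k, ∑ p, ∑ i, ∑ j, W (i, k) (j, k) * W (j, p) (i, p) =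
        ∑ i, ∑ j, (∑ k, W (i, k) (j, k)) * (∑ k, W (j, k) (i, k)) := by
      rw [sum4_comm]
      simp only [← Finset.mul_sum, ← Finset.sum_mul]
    have C : ∑ k, ∑ l, ∑ i, ∑ j, W (i, k) (i, l) * W (j, l) (j, k) =
        ∑ k, ∑ l, (∑ i, W (i, k) (i, l)) * (∑ i, W (i, l) (i, k)) := by
      simp only [← Finset.mul_sum, ← Finset.sum_mul]
    have D : ∑ k, ∑ l, ∑ i, ∑ j, W (i, k) (j, l) * W (j, l) (i, k) = (W * W).trace := by
      rw [sum4_comm]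
      simp only [trace, diag, Matrix.mul_apply, Fintype.sum_prod_type]
      exact Finset.sum_congr rfl fun i _ => Finset.sum_comm
    rw [A, B, C, D] at h
    exact h
  · intro b
    have e : quart (fun k l p q => ∑ i, ∑ j,
      (W (i, k) (i, l) * W (j, p) (j, q) - W (i, k) (j, l) * W (j, p) (i, q))) b =
      ∑ i, ∑ j, (contr W b i i * contr W b j j - contr W b i j * contr W b j i) := by
      have e1 : ∀ i j, contr W b i i * contr W b j j - contr W b i j * contr W b j i =
          ∑ k, ∑ l, ∑ p, ∑ q, (star (b k) * b l * star (b p) * b q) *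
          (W (i, k) (i, l) * W (j, p) (j, q) - W (i, k) (j, l) * W (j, p) (i, q)) := by
        intro i j
        simp only [contr_mul, mul_sub, Finset.sum_sub_distrib]
      simp only [e1]
      rw [← sum4_comm (fun k l i j => ∑ p, ∑ q, (star (b k) * b l * star (b p) * b q) *
          (W (i, k) (i, l) * W (j, p) (j, q) - W (i, k) (j, l) * W (j, p) (i, q)))]
      refine Finset.sum_congr rfl fun k _ => Finset.sum_congr rfl fun l _ => ?_
      simp only [Finset.mul_sum]
      exact sum4_comm (fun p q i j => (star (b k) * b l * star (b p) * b q) *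
          (W (i, k) (i, l) * W (j, p) (j, q) - W (i, k) (j, l) * W (j, p) (i, q)))
    rw [e]
    exact Finset.sum_nonneg fun i _ => Finset.sum_nonneg fun j _ => psd_minor (contr_psd hBP b) i j

lemma swap_bp {m : ℕ} {W : Matrix (Fin m × Fin m) (Fin m × Fin m) ℂ}
    (hBP : BlockPositive W) : BlockPositive (W.submatrix Prod.swap Prod.swap) := by
  refine ⟨hBP.1.submatrix _, fun a b => ?_⟩
  have e : star (prodVec a b) ⬝ᵥ (W.submatrix Prod.swap Prod.swap).mulVec (prodVec a b) =
      star (prodVec b a) ⬝ᵥ W.mulVec (prodVec b a) := by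
    simp only [dotProduct, mulVec]
    rw [← Equiv.sum_comp (Equiv.prodComm (Fin m) (Fin m))]
    refine Finset.sum_congr rfl fun x _ => ?_
    rw [← Equiv.sum_comp (Equiv.prodComm (Fin m) (Fin m))]
    simp [prodVec, mul_comm]
  rw [e]; exact hBP.2 b a

lemma trace_sq_le {m : ℕ} {W : Matrix (Fin m × Fin m) (Fin m × Fin m) ℂ}
    (hBP : BlockPositive W) : (W * W).trace ≤ W.trace ^ 2 := by
  have h1 := one_side hBP
  have h2 := one_side (swap_bp hBP)
  have t1 : (W.submatrix Prod.swap Prod.swap).trace = W.trace := by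
    simp only [trace, diag]
    exact Equiv.sum_comp (Equiv.prodComm (Fin m) (Fin m)) fun x => W x x
  have t2 : (W.submatrix Prod.swap Prod.swap * W.submatrix Prod.swap Prod.swap).trace
      = (W * W).trace := by
    simp only [trace, diag, Matrix.mul_apply]
    rw [← Equiv.sum_comp (Equiv.prodComm (Fin m) (Fin m))]
    refine Finset.sum_congr rfl fun x _ => ?_
    rw [← Equiv.sum_comp (Equiv.prodComm (Fin m) (Fin m))]
    simp
  rw [t1, t2] at h2
  simp only [submatrix_apply, Prod.swap_prod_mk] at h2
  have h3 := add_nonneg h1 h2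
  have h4 : 0 ≤ 2 * (W.trace ^ 2 - (W * W).trace) := by
    refine h3.trans_eq ?_
    ring
  have h5 := nonneg_of_ofReal_mul (r := 2) (by norm_num) (by exact_mod_cast h4)
  exact sub_nonneg.1 h5

lemma trace_sq_eig {n : Type*} [Fintype n] [DecidableEq n] {W : Matrix n n ℂ}
    (hW : W.IsHermitian) : (W * W).trace = ((∑ i, hW.eigenvalues i ^ 2 : ℝ) : ℂ) := by
  conv_lhs => rw [hW.spectral_theorem, ← map_mul, Unitary.conjStarAlgAut_apply, trace_mul_comm,
    ← mul_assoc]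
  simp [trace, diagonal_mul_diagonal, sq]

/-- For a normalized `m × m` entanglement witness, `N(W) ≤ (m-1)/2`; in the
case of equality the eigenvalues are `1/m` with multiplicity `m(m+1)/2` and
`-1/m` with multiplicity `m(m-1)/2`. -/
theorem stmt_9 {m : ℕ} (hm : 2 ≤ m)
    (W : Matrix (Fin m × Fin m) (Fin m × Fin m) ℂ)
    (hBP : BlockPositive W) (hNP : ¬ W.PosSemidef) (htr : W.trace = 1) :
    negativity hBP.1 ≤ ((m : ℝ) - 1) / 2 ∧
    (negativity hBP.1 = ((m : ℝ) - 1) / 2 →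
      Multiset.map hBP.1.eigenvalues Finset.univ.val =
        Multiset.replicate (m * (m + 1) / 2) ((1 : ℝ) / m) +
        Multiset.replicate (m * (m - 1) / 2) (-(1 / (m : ℝ)))) := by
  have h1 := trace_sq_le hBP
  rw [trace_sq_eig hBP.1, htr] at h1
  have h2 := hBP.1.trace_eq_sum_eigenvalues
  rw [htr] at h2
  unfold negativity
  generalize hBP.1.eigenvalues = f at h1 h2 ⊢
  have hsq : ∑ i, f i ^ 2 ≤ 1 := by
    have : ((∑ i, f i ^ 2 : ℝ) : ℂ) ≤ ((1 : ℝ) : ℂ) := by simpa using h1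
    exact_mod_cast this
  have hsum : ∑ i, f i = 1 := by
    have : ((∑ i, f i : ℝ) : ℂ) = ((1 : ℝ) : ℂ) := by simpa using h2.symm
    exact_mod_cast this
  have hm0 : (0 : ℝ) < m := by exact_mod_cast (by omega : 0 < m)
  have hneg : ∑ i, max (-(f i)) 0 = (∑ i, |f i| - 1) / 2 := by
    rw [← hsum, ← Finset.sum_sub_distrib, Finset.sum_div]
    refine Finset.sum_congr rfl fun i _ => ?_
    rcases le_total 0 (f i) with h | h
    · rw [abs_of_nonneg h, max_eq_right (by linarith)]; ring
    · rw [abs_of_nonpos h, max_eq_left (by linarith)]; ring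
  have key : ∑ i, (|f i| - 1 / m) ^ 2 = ∑ i, f i ^ 2 - 2 / m * ∑ i, |f i| + 1 := by
    have : ∀ i, (|f i| - 1 / m) ^ 2 = f i ^ 2 - 2 / m * |f i| + 1 / m ^ 2 := by
      intro i; rw [sub_sq, sq_abs]; ring
    simp only [this, Finset.sum_add_distrib, Finset.sum_sub_distrib, ← Finset.mul_sum]
    simp
    field_simp
  have hpos : 0 ≤ ∑ i, (|f i| - 1 / m) ^ 2 := Finset.sum_nonneg fun i _ => sq_nonneg _
  rw [hneg]
  refine ⟨?_, fun heq => ?_⟩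
  · have h3 : 2 / m * ∑ i, |f i| ≤ 2 := by linarith
    have h4 : ∑ i, |f i| ≤ m := by
      rw [div_mul_eq_mul_div, div_le_iff₀ hm0] at h3
      linarith
    linarith
  · have hS : ∑ i, |f i| = m := by linarith
    have h0 : ∑ i, (|f i| - 1 / m) ^ 2 = 0 := by
      refine le_antisymm ?_ hpos
      rw [key, hS, div_mul_cancel₀ _ hm0.ne']
      linarith
    have habs : ∀ i, |f i| = 1 / m := by
      intro i
      have := (Finset.sum_eq_zero_iff_of_nonneg (fun i _ => sq_nonneg _)).1 h0 i (Finset.mem_univ i)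
      exact sub_eq_zero.1 (pow_eq_zero_iff (two_ne_zero) |>.1 this)
    set s : Multiset ℝ := Multiset.map f Finset.univ.val with hs
    have hmem : ∀ x ∈ s, x = 1 / m ∨ x = -(1 / (m : ℝ)) := by
      intro x hx
      obtain ⟨i, -, rfl⟩ := Multiset.mem_map.1 hx
      exact eq_or_eq_neg_of_abs_eq (habs i)
    have hcard : s.card = m * m := by simp [hs]
    have hssum : s.sum = 1 := hsum
    have hsplit := Multiset.filter_add_not (fun x => x = 1 / (m : ℝ)) s
    have e1 : s.filter (fun x => x = 1 / (m : ℝ)) =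
        Multiset.replicate (s.filter (fun x => x = 1 / (m : ℝ))).card (1 / (m : ℝ)) :=
      Multiset.eq_replicate_card.2 fun x hx => (Multiset.mem_filter.1 hx).2
    have e2 : s.filter (fun x => ¬ x = 1 / (m : ℝ)) =
        Multiset.replicate (s.filter (fun x => ¬ x = 1 / (m : ℝ))).card (-(1 / (m : ℝ))) :=
      Multiset.eq_replicate_card.2 fun x hx =>
        (hmem x (Multiset.mem_filter.1 hx).1).resolve_left (Multiset.mem_filter.1 hx).2
    rw [e1, e2] at hsplit
    generalize (s.filter (fun x => x = 1 / (m : ℝ))).card = P at hsplit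
    generalize (s.filter (fun x => ¬ x = 1 / (m : ℝ))).card = Q at hsplit
    rw [← hsplit] at hcard hssum
    simp only [Multiset.card_add, Multiset.card_replicate, Multiset.sum_add,
      Multiset.sum_replicate, nsmul_eq_mul] at hcard hssum
    have hd : (P : ℝ) = Q + m := by
      field_simp at hssum
      linarith
    have hdn : P = Q + m := by exact_mod_cast hd
    obtain ⟨r, rfl⟩ : ∃ r, m = r + 1 := ⟨m - 1, by omega⟩
    have hQ : Q = (r + 1) * (r + 1 - 1) / 2 := by
      rw [Nat.add_sub_cancel]
      symm
      apply Nat.div_eq_of_eq_mul_right (by norm_num)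
      nlinarith
    have hP : P = (r + 1) * (r + 1 + 1) / 2 := by
      symm
      apply Nat.div_eq_of_eq_mul_right (by norm_num)
      nlinarith
    rw [← hsplit, ← hQ, ← hP]

end
end

section
/- Let m, n ≥ 2 and let W be a normalized m×n decomposable entanglement witness (i.e., W = P + Q^Γ with P, Q positive semidefinite, tr(W) = 1, and W is not positive semidefinite). Then the smallest eigenvalue of W equals −1/2 if and only if there exist orthonormal vectors b₁, b₂ : Fin m → ℂ and orthonormal vectors c₁, c₂ : Fin n → ℂ such that W = (φ φᴴ)^Γ, where φ = (1/√2) (b₁⊗c₁ + b₂⊗c₂), i.e., W is the partial transpose of a pure state whose two nonzero Schmidt coefficients are both √2/2. -/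
open Matrix ComplexOrder

noncomputable section

/-! ### Helper lemmas -/

lemma aux_sq {ι : Type*} [Fintype ι] (K D : ι → ℂ) (t : ℝ) :
    ∑ i, Complex.normSq (K i - t * D i) =
      ∑ i, Complex.normSq (K i) - 2 * t * ∑ i, (K i * (starRingEnd ℂ) (D i)).re
        + t ^ 2 * ∑ i, Complex.normSq (D i) := by
  rw [Finset.mul_sum, Finset.mul_sum, ← Finset.sum_sub_distrib, ← Finset.sum_add_distrib]
  refine Finset.sum_congr rfl fun i _ => ?_
  simp [Complex.normSq_apply]
  ring

lemma aux_cs {ι : Type*} [Fintype ι] (K D : ι → ℂ) :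
    (∑ i, (K i * (starRingEnd ℂ) (D i)).re) ^ 2 ≤
      (∑ i, Complex.normSq (K i)) * ∑ i, Complex.normSq (D i) := by
  have h : ∀ t : ℝ, 0 ≤ (∑ i, Complex.normSq (D i)) * (t * t)
      + (-2 * ∑ i, (K i * (starRingEnd ℂ) (D i)).re) * t + ∑ i, Complex.normSq (K i) := by
    intro t
    have h1 := aux_sq K D t
    have h2 : 0 ≤ ∑ i, Complex.normSq (K i - t * D i) :=
      Finset.sum_nonneg fun i _ => Complex.normSq_nonneg _
    linarith
  have := discrim_le_zero h
  unfold discrim at this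
  nlinarith

lemma aux_wedge {n : ℕ} (a b : Fin n → ℂ) :
    ∑ p : Fin n × Fin n, Complex.normSq (a p.1 * b p.2 - b p.1 * a p.2) =
      2 * (∑ k, Complex.normSq (a k)) * (∑ k, Complex.normSq (b k))
        - 2 * Complex.normSq (∑ k, a k * (starRingEnd ℂ) (b k)) := by
  apply Complex.ofReal_injective
  push_cast
  simp only [← Complex.mul_conj, map_sub, map_mul, map_sum, Complex.conj_conj]
  have e : ∀ p : Fin n × Fin n, (a p.1 * b p.2 - b p.1 * a p.2) *
      ((starRingEnd ℂ) (a p.1) * (starRingEnd ℂ) (b p.2)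
        - (starRingEnd ℂ) (b p.1) * (starRingEnd ℂ) (a p.2)) =
      (a p.1 * (starRingEnd ℂ) (a p.1)) * (b p.2 * (starRingEnd ℂ) (b p.2))
      + (b p.1 * (starRingEnd ℂ) (b p.1)) * (a p.2 * (starRingEnd ℂ) (a p.2))
      - (a p.1 * (starRingEnd ℂ) (b p.1)) * ((starRingEnd ℂ) (a p.2) * b p.2)
      - ((starRingEnd ℂ) (a p.1) * b p.1) * (a p.2 * (starRingEnd ℂ) (b p.2)) := by
    intro p; ring
  simp only [e, Finset.sum_sub_distrib, Finset.sum_add_distrib, Fintype.sum_prod_type,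
    ← Finset.sum_mul_sum]
  ring

/-- `C k l = ∑ j, φ (j,k) ψ (j,l)`. -/
def Cm {m n : ℕ} (φ ψ : Fin m × Fin n → ℂ) (k l : Fin n) : ℂ := ∑ j, φ (j, k) * ψ (j, l)

/-- The quadratic form of the partial transpose of `φ φᴴ`. -/
def Fr {m n : ℕ} (φ ψ : Fin m × Fin n → ℂ) : ℝ :=
  ∑ p : Fin n × Fin n, (Cm φ ψ p.1 p.2 * (starRingEnd ℂ) (Cm φ ψ p.2 p.1)).re

lemma form_eq {m n : ℕ} (φ ψ : Fin m × Fin n → ℂ) :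
    (star ψ ⬝ᵥ (ptrans (vecMulVec φ (star φ))) *ᵥ ψ).re = Fr φ ψ := by
  unfold Fr
  rw [← Complex.re_sum]
  congr 1
  simp only [dotProduct, mulVec, ptrans, vecMulVec_apply, Cm, Fintype.sum_prod_type, map_sum,
    map_mul, Pi.star_apply, Complex.star_def, Finset.mul_sum, Finset.sum_mul]
  rw [Finset.sum_comm]
  refine Finset.sum_congr rfl fun k _ => ?_
  rw [Finset.sum_comm]
  conv_lhs => enter [2, j]; rw [Finset.sum_comm]
  rw [Finset.sum_comm]
  refine Finset.sum_congr rfl fun l _ => ?_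
  rw [Finset.sum_comm]
  conv_rhs => rw [Finset.sum_comm]
  rw [Finset.sum_comm]
  refine Finset.sum_congr rfl fun j _ => ?_
  refine Finset.sum_congr rfl fun i _ => ?_
  ring

lemma Fr_split {m n : ℕ} (φ ψ : Fin m × Fin n → ℂ) :
    4 * Fr φ ψ = ∑ p : Fin n × Fin n, Complex.normSq (Cm φ ψ p.1 p.2 + Cm φ ψ p.2 p.1)
      - ∑ p : Fin n × Fin n, Complex.normSq (Cm φ ψ p.1 p.2 - Cm φ ψ p.2 p.1) := by
  unfold Fr
  rw [Finset.mul_sum, ← Finset.sum_sub_distrib]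
  refine Finset.sum_congr rfl fun i _ => ?_
  simp [Complex.normSq_apply]
  ring

/-- Everything about the bound in one place. -/
lemma core_s11 {m n : ℕ} (φ ψ : Fin m × Fin n → ℂ)
    (hφ : ∑ p, Complex.normSq (φ p) = 1) (hψ : ∑ p, Complex.normSq (ψ p) = 1) :
    -(1/2) ≤ Fr φ ψ ∧ (Fr φ ψ = -(1/2) →
      (∀ k l, Cm φ ψ l k = - Cm φ ψ k l) ∧
      (∀ j, ∑ k, Complex.normSq (φ (j,k)) = ∑ k, Complex.normSq (ψ (j,k))) ∧
      (∀ j, ∑ k, φ (j,k) * (starRingEnd ℂ) (ψ (j,k)) = 0) ∧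
      (∀ j k l, φ (j,k) * ψ (j,l) - ψ (j,k) * φ (j,l) =
        ((∑ k, Complex.normSq (ψ (j,k)) : ℝ) : ℂ) * (2 * Cm φ ψ k l))) := by
  set D : Fin n × Fin n → ℂ := fun p => Cm φ ψ p.1 p.2 - Cm φ ψ p.2 p.1 with hD
  set K : Fin m → Fin n × Fin n → ℂ :=
    fun j p => φ (j,p.1) * ψ (j,p.2) - ψ (j,p.1) * φ (j,p.2) with hK
  set s : Fin m → ℝ := fun j => ∑ k, Complex.normSq (φ (j,k)) with hs
  set r : Fin m → ℝ := fun j => ∑ k, Complex.normSq (ψ (j,k)) with hr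
  set g : Fin m → ℝ := fun j => ∑ p, (K j p * (starRingEnd ℂ) (D p)).re with hg
  set w : Fin m → ℝ := fun j => Complex.normSq (∑ k, φ (j,k) * (starRingEnd ℂ) (ψ (j,k))) with hw
  set d : ℝ := ∑ p, Complex.normSq (D p) with hd
  set σ : ℝ := ∑ p : Fin n × Fin n, Complex.normSq (Cm φ ψ p.1 p.2 + Cm φ ψ p.2 p.1) with hσ
  have hF : 4 * Fr φ ψ = σ - d := Fr_split φ ψ
  have hσ0 : 0 ≤ σ := Finset.sum_nonneg fun i _ => Complex.normSq_nonneg _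
  have hd0 : 0 ≤ d := Finset.sum_nonneg fun i _ => Complex.normSq_nonneg _
  have hs0 : ∀ j, 0 ≤ s j := fun j => Finset.sum_nonneg fun i _ => Complex.normSq_nonneg _
  have hr0 : ∀ j, 0 ≤ r j := fun j => Finset.sum_nonneg fun i _ => Complex.normSq_nonneg _
  have hw0 : ∀ j, 0 ≤ w j := fun j => Complex.normSq_nonneg _
  have hs1 : ∑ j, s j = 1 := by rw [← hφ, Fintype.sum_prod_type]
  have hr1 : ∑ j, r j = 1 := by rw [← hψ, Fintype.sum_prod_type]
  have hKn : ∀ j, ∑ p, Complex.normSq (K j p) = 2 * s j * r j - 2 * w j :=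
    fun j => aux_wedge (fun k => φ (j,k)) (fun k => ψ (j,k))
  have hKD : ∀ p, ∑ j, K j p = D p := by
    intro p
    simp only [hK, hD, Cm, Finset.sum_sub_distrib]
    congr 1
    exact Finset.sum_congr rfl fun _ _ => mul_comm _ _
  have hgd : ∑ j, g j = d := by
    simp only [hg, hd]
    rw [Finset.sum_comm]
    refine Finset.sum_congr rfl fun p _ => ?_
    rw [← Complex.re_sum, ← Finset.sum_mul, hKD, Complex.mul_conj, Complex.ofReal_re]
  have hcs : ∀ j, g j ^ 2 ≤ (2 * s j * r j - 2 * w j) * d := by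
    intro j; rw [← hKn]; exact aux_cs (K j) D
  obtain ⟨x, hx0, hx⟩ : ∃ x : ℝ, 0 ≤ x ∧ d = 2 * x ^ 2 :=
    ⟨√(d/2), Real.sqrt_nonneg _, by rw [Real.sq_sqrt (by linarith)]; ring⟩
  have hgx : ∀ j, g j ≤ x * (s j + r j) := by
    intro j
    refine (abs_le_of_sq_le_sq (b := x * (s j + r j)) ?_ ?_) |> (le_abs_self _).trans
    · have := hcs j
      rw [hx] at this
      nlinarith [mul_nonneg (sq_nonneg x) (sq_nonneg (s j - r j)), mul_nonneg (sq_nonneg x) (hw0 j)]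
    · exact mul_nonneg hx0 (add_nonneg (hs0 j) (hr0 j))
  have hsum : ∑ j, x * (s j + r j) = 2 * x := by
    rw [← Finset.mul_sum, Finset.sum_add_distrib, hs1, hr1]; ring
  have hdx : d ≤ 2 * x := by
    rw [← hgd, ← hsum]; exact Finset.sum_le_sum fun j _ => hgx j
  have hx1 : x ≤ 1 := by nlinarith
  refine ⟨by nlinarith, fun hE => ?_⟩
  have hx1' : x = 1 := by nlinarith
  have hd2 : d = 2 := by rw [hx, hx1']; norm_num
  have hσz : σ = 0 := by linarith
  have hanti : ∀ k l, Cm φ ψ l k = - Cm φ ψ k l := by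
    intro k l
    have := (Finset.sum_eq_zero_iff_of_nonneg (fun i _ => Complex.normSq_nonneg _)).1 hσz (k, l)
      (Finset.mem_univ _)
    rw [Complex.normSq_eq_zero] at this
    linear_combination this
  have hge : ∀ j, g j = s j + r j := by
    have h1 : ∑ j, g j = ∑ j, x * (s j + r j) := by rw [hgd, hsum, hd2, hx1']; norm_num
    have := (Finset.sum_eq_sum_iff_of_le (fun j _ => hgx j)).1 h1
    intro j
    rw [this j (Finset.mem_univ _), hx1', one_mul]
  have hsr : ∀ j, s j = r j ∧ w j = 0 := by
    intro j
    have h := hcs j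
    rw [hge, hd2] at h
    have h1 := hw0 j
    have h2 : (s j - r j) ^ 2 = 0 := le_antisymm (by nlinarith) (sq_nonneg _)
    exact ⟨by have := pow_eq_zero_iff (two_ne_zero) |>.1 h2; linarith, by nlinarith⟩
  refine ⟨hanti, fun j => (hsr j).1, fun j => Complex.normSq_eq_zero.1 (hsr j).2, ?_⟩
  intro j k l
  have h0 : ∑ p, Complex.normSq (K j p - (r j : ℝ) * D p) = 0 := by
    rw [aux_sq, hKn]
    have h3 : ∑ p, (K j p * (starRingEnd ℂ) (D p)).re = s j + r j := hge j
    have h4 : ∑ p, Complex.normSq (D p) = 2 := hd2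
    rw [h3, h4, (hsr j).1, (hsr j).2]; ring
  have := (Finset.sum_eq_zero_iff_of_nonneg (fun i _ => Complex.normSq_nonneg _)).1 h0 (k, l)
      (Finset.mem_univ _)
  rw [Complex.normSq_eq_zero] at this
  simp only [hK, hD] at this
  have h5 := hanti k l
  rw [h5] at this
  linear_combination this

lemma li {n : ℕ} {e f : Fin n → ℂ} (he : ∑ k, e k * (starRingEnd ℂ) (e k) = 1)
    (hf : ∑ k, f k * (starRingEnd ℂ) (f k) = 1) (hef : ∑ k, e k * (starRingEnd ℂ) (f k) = 0)
    {x y : ℂ} (h : ∀ l, x * e l + y * f l = 0) : x = 0 ∧ y = 0 := by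
  have hfe : ∑ k, f k * (starRingEnd ℂ) (e k) = 0 := by
    have := congrArg (starRingEnd ℂ) hef
    simpa [mul_comm] using this
  constructor
  · have : ∑ l, (x * e l + y * f l) * (starRingEnd ℂ) (e l) = 0 := by simp [h]
    simp only [add_mul, Finset.sum_add_distrib, mul_assoc, ← Finset.mul_sum, he, hfe] at this
    simpa using this
  · have : ∑ l, (x * e l + y * f l) * (starRingEnd ℂ) (f l) = 0 := by simp [h]
    simp only [add_mul, Finset.sum_add_distrib, mul_assoc, ← Finset.mul_sum, hf, hef] at this
    simpa using this

/-- Structure of an extremal pair. -/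
structure ExtPair {m n : ℕ} (φ ψ : Fin m × Fin n → ℂ) (e f : Fin n → ℂ) (u v : Fin m → ℂ) : Prop where
  he : ∑ k, e k * (starRingEnd ℂ) (e k) = 1
  hf : ∑ k, f k * (starRingEnd ℂ) (f k) = 1
  hef : ∑ k, e k * (starRingEnd ℂ) (f k) = 0
  hu : ∑ k, u k * (starRingEnd ℂ) (u k) = 1/2
  hv : ∑ k, v k * (starRingEnd ℂ) (v k) = 1/2
  huv : ∑ k, u k * (starRingEnd ℂ) (v k) = 0
  hφ : ∀ j k, φ (j,k) = u j * e k + v j * f k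
  hψ : ∀ j k, ψ (j,k) = -(starRingEnd ℂ) (v j) * e k + (starRingEnd ℂ) (u j) * f k

lemma struct_ext {m n : ℕ} (ψ : Fin m × Fin n → ℂ) (hψ : ∑ p, Complex.normSq (ψ p) = 1) :
    ∃ f : Fin n → ℂ, ∀ φ : Fin m × Fin n → ℂ, ∑ p, Complex.normSq (φ p) = 1 →
      Fr φ ψ = -(1/2) → ∃ e u v, ExtPair φ ψ e f u v := by
  obtain ⟨j0, hj0⟩ : ∃ j, ∑ k, Complex.normSq (ψ (j,k)) ≠ 0 := by
    by_contra! h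
    rw [Fintype.sum_prod_type] at hψ
    simp [h] at hψ
  set r : Fin m → ℝ := fun j => ∑ k, Complex.normSq (ψ (j,k)) with hr
  have hr0 : ∀ j, 0 ≤ r j := fun j => Finset.sum_nonneg fun i _ => Complex.normSq_nonneg _
  obtain ⟨R, hR0, hR⟩ : ∃ R : ℝ, R ≠ 0 ∧ R * R = r j0 :=
    ⟨√(r j0), (Real.sqrt_ne_zero (hr0 _)).2 hj0, Real.mul_self_sqrt (hr0 _)⟩
  have hRc : (R : ℂ) ≠ 0 := by exact_mod_cast hR0
  have hRR : (R : ℂ) * R = r j0 := by exact_mod_cast hR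
  refine ⟨fun k => ψ (j0,k) / R, fun φ hφ hE => ?_⟩
  obtain ⟨hanti, hsr, hip, hK⟩ := (core_s11 φ ψ hφ hψ).2 hE
  have hip' : ∀ j, ∑ k, ψ (j,k) * (starRingEnd ℂ) (φ (j,k)) = 0 := by
    intro j
    have := congrArg (starRingEnd ℂ) (hip j)
    simpa [mul_comm] using this
  have hψψ : ∀ j, ∑ k, ψ (j,k) * (starRingEnd ℂ) (ψ (j,k)) = r j := by
    intro j; simp [hr, Complex.mul_conj]
  have hφφ : ∀ j, ∑ k, φ (j,k) * (starRingEnd ℂ) (φ (j,k)) = r j := by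
    intro j; rw [hr]; simp only; rw [← hsr]; simp [Complex.mul_conj]
  have zero_of : ∀ (χ : Fin m × Fin n → ℂ) j, ∑ k, Complex.normSq (χ (j,k)) = 0 →
      ∀ k, χ (j,k) = 0 := by
    intro χ j h k
    have := (Finset.sum_eq_zero_iff_of_nonneg (fun i _ => Complex.normSq_nonneg _)).1 h k
      (Finset.mem_univ _)
    exact Complex.normSq_eq_zero.1 this
  have hA : ∀ j k, φ (j,k) = ∑ l, 2 * Cm φ ψ k l * (starRingEnd ℂ) (ψ (j,l)) := by
    intro j k
    by_cases h0 : r j = 0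
    · rw [zero_of φ j (by rw [hsr]; exact h0) k]
      simp [zero_of ψ j h0]
    · have h0c : (r j : ℂ) ≠ 0 := by exact_mod_cast h0
      apply mul_left_cancel₀ h0c
      have h1 : ∑ l, (φ (j,k) * ψ (j,l) - ψ (j,k) * φ (j,l)) * (starRingEnd ℂ) (ψ (j,l))
        = φ (j,k) * r j := by
        simp only [sub_mul, Finset.sum_sub_distrib, mul_assoc, ← Finset.mul_sum, hψψ, hip]
        ring
      rw [mul_comm, ← h1, Finset.mul_sum]
      refine Finset.sum_congr rfl fun l _ => ?_
      rw [hK]; ring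
  have hB : ∀ j k, ψ (j,k) = -∑ l, 2 * Cm φ ψ k l * (starRingEnd ℂ) (φ (j,l)) := by
    intro j k
    by_cases h0 : r j = 0
    · rw [zero_of ψ j h0 k]
      simp [zero_of φ j (by rw [hsr]; exact h0)]
    · have h0c : (r j : ℂ) ≠ 0 := by exact_mod_cast h0
      apply mul_left_cancel₀ h0c
      have h1 : ∑ l, (φ (j,k) * ψ (j,l) - ψ (j,k) * φ (j,l)) * (starRingEnd ℂ) (φ (j,l))
        = -(ψ (j,k) * r j) := by
        simp only [sub_mul, Finset.sum_sub_distrib, mul_assoc, ← Finset.mul_sum, hφφ, hip']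
        ring
      rw [mul_comm, ← neg_neg (ψ (j,k) * _), ← h1, mul_neg, Finset.mul_sum]
      congr 1
      refine Finset.sum_congr rfl fun l _ => ?_
      rw [hK]; ring
  set f : Fin n → ℂ := fun k => ψ (j0,k) / R with hfdef
  set e : Fin n → ℂ := fun k => φ (j0,k) / R with hedef
  have hRR' : (R : ℂ) ^ 2 = r j0 := by rw [← hRR]; ring
  have hC : ∀ k l, 2 * Cm φ ψ k l = e k * f l - f k * e l := by
    intro k l
    have h := hK j0 k l
    have h2 : φ (j0,k) * ψ (j0,l) - ψ (j0,k) * φ (j0,l) = (R:ℂ)^2 * (2 * Cm φ ψ k l) := by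
      rw [h, hRR']
    simp only [hedef, hfdef]
    field_simp
    linear_combination -h2
  have ortho : ∀ (x y : Fin n → ℂ), ∑ k, x k / R * (starRingEnd ℂ) (y k / R) =
      (∑ k, x k * (starRingEnd ℂ) (y k)) / r j0 := by
    intro x y
    rw [Finset.sum_div]
    refine Finset.sum_congr rfl fun k _ => ?_
    rw [← hRR, map_div₀, Complex.conj_ofReal]
    field_simp
  have hj0c : (r j0 : ℂ) ≠ 0 := by exact_mod_cast hj0
  have he : ∑ k, e k * (starRingEnd ℂ) (e k) = 1 := by
    rw [ortho (fun k => φ (j0,k)) (fun k => φ (j0,k)), hφφ, div_self hj0c]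
  have hf : ∑ k, f k * (starRingEnd ℂ) (f k) = 1 := by
    rw [ortho (fun k => ψ (j0,k)) (fun k => ψ (j0,k)), hψψ, div_self hj0c]
  have hef : ∑ k, e k * (starRingEnd ℂ) (f k) = 0 := by
    rw [ortho (fun k => φ (j0,k)) (fun k => ψ (j0,k)), hip, zero_div]
  have hfe : ∑ k, f k * (starRingEnd ℂ) (e k) = 0 := by
    rw [ortho (fun k => ψ (j0,k)) (fun k => φ (j0,k)), hip', zero_div]
  set u : Fin m → ℂ := fun j => ∑ l, f l * (starRingEnd ℂ) (ψ (j,l)) with hu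
  set v : Fin m → ℂ := fun j => -∑ l, e l * (starRingEnd ℂ) (ψ (j,l)) with hv
  have hφ' : ∀ j k, φ (j,k) = u j * e k + v j * f k := by
    intro j k
    rw [hA]
    simp only [hC, sub_mul, Finset.sum_sub_distrib, mul_assoc, ← Finset.mul_sum, hu, hv]
    ring
  have hψ' : ∀ j k, ψ (j,k) = -(starRingEnd ℂ) (v j) * e k + (starRingEnd ℂ) (u j) * f k := by
    intro j k
    have h1 : ∑ l, f l * (starRingEnd ℂ) (φ (j,l)) = (starRingEnd ℂ) (v j) := by
      simp only [hφ', map_add, map_mul, mul_add, Finset.sum_add_distrib, mul_left_comm (f _),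
        ← Finset.mul_sum, hfe, hf]
      ring
    have h2 : ∑ l, e l * (starRingEnd ℂ) (φ (j,l)) = (starRingEnd ℂ) (u j) := by
      simp only [hφ', map_add, map_mul, mul_add, Finset.sum_add_distrib, mul_left_comm (e _),
        ← Finset.mul_sum, he, hef]
      ring
    rw [hB]
    simp only [hC, sub_mul, Finset.sum_sub_distrib, mul_assoc, ← Finset.mul_sum, h1, h2]
    ring
  have hmix : ∀ k l,
      (-(∑ j, u j * (starRingEnd ℂ) (v j)) * e k + (1/2 - ∑ j, v j * (starRingEnd ℂ) (v j)) * f k) * e l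
      + ((∑ j, u j * (starRingEnd ℂ) (u j) - 1/2) * e k + (∑ j, v j * (starRingEnd ℂ) (u j)) * f k) * f l
      = 0 := by
    intro k l
    have h1 : Cm φ ψ k l = -(∑ j, u j * (starRingEnd ℂ) (v j)) * e k * e l
        + (∑ j, u j * (starRingEnd ℂ) (u j)) * e k * f l
        - (∑ j, v j * (starRingEnd ℂ) (v j)) * f k * e l
        + (∑ j, v j * (starRingEnd ℂ) (u j)) * f k * f l := by
      simp only [Cm, Finset.sum_mul, ← Finset.sum_neg_distrib, ← Finset.sum_add_distrib,
        ← Finset.sum_sub_distrib]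
      refine Finset.sum_congr rfl fun j _ => ?_
      rw [hφ', hψ']
      ring
    have h2 := hC k l
    linear_combination h2 / 2 - h1
  have hm1 := fun k => li he hf hef (hmix k)
  have hm2 := li he hf hef fun k => (hm1 k).1
  have hm3 := li he hf hef fun k => (hm1 k).2
  exact ⟨e, u, v, he, hf, hef, sub_eq_zero.1 hm3.1, (sub_eq_zero.1 hm2.2).symm,
    neg_eq_zero.1 hm2.1, hφ', hψ'⟩

lemma ext_unique {m n : ℕ} {φ φ' ψ : Fin m × Fin n → ℂ} {e e' f : Fin n → ℂ} {u u' v v' : Fin m → ℂ}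
    (h : ExtPair φ ψ e f u v) (h' : ExtPair φ' ψ e' f u' v') : ∃ z : ℂ, z ≠ 0 ∧ ∀ p, φ p = z * φ' p := by
  have key : ∀ {φ ψ : Fin m × Fin n → ℂ} {e : Fin n → ℂ} {u v : Fin m → ℂ}, ExtPair φ ψ e f u v →
      ∀ j, ∑ k, ψ (j,k) * (starRingEnd ℂ) (f k) = (starRingEnd ℂ) (u j) := by
    intro φ ψ e u v h j
    simp only [h.hψ, add_mul, Finset.sum_add_distrib, mul_assoc, ← Finset.mul_sum, h.hf, h.hef]
    ring
  have huu : ∀ j, u j = u' j := fun j =>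
    (starRingEnd ℂ).injective ((key h j).symm.trans (key h' j))
  have hvv : ∀ j k, (starRingEnd ℂ) (v j) * e k = (starRingEnd ℂ) (v' j) * e' k := by
    intro j k
    have h1 := h.hψ j k
    have h2 := h'.hψ j k
    rw [huu] at h1
    linear_combination h1 - h2
  obtain ⟨j, hj⟩ : ∃ j, v j ≠ 0 := by
    by_contra! hh
    have := h.hv
    simp [hh] at this
  have hjc : (starRingEnd ℂ) (v j) ≠ 0 := by simpa using hj
  obtain ⟨z, hz⟩ : ∃ z : ℂ, ∀ k, e k = z * e' k :=
    ⟨(starRingEnd ℂ) (v' j) / (starRingEnd ℂ) (v j), fun k => by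
      have := hvv j k
      field_simp
      linear_combination this⟩
  have hzz : z * (starRingEnd ℂ) z = 1 := by
    have h1 := h.he
    have h2 : ∑ k, e k * (starRingEnd ℂ) (e k)
        = z * (starRingEnd ℂ) z * ∑ k, e' k * (starRingEnd ℂ) (e' k) := by
      rw [Finset.mul_sum]
      refine Finset.sum_congr rfl fun k _ => ?_
      rw [hz, map_mul]; ring
    rw [h1, h'.he] at h2
    linear_combination -h2
  have hv2 : ∀ j, (starRingEnd ℂ) (v' j) = (starRingEnd ℂ) (v j) * z := by
    intro j
    have h1 : ∑ k, (starRingEnd ℂ) (v' j) * e' k * (starRingEnd ℂ) (e' k)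
      = ∑ k, (starRingEnd ℂ) (v j) * z * (e' k * (starRingEnd ℂ) (e' k)) := by
      refine Finset.sum_congr rfl fun k _ => ?_
      rw [← hvv, hz]; ring
    simp only [mul_assoc, ← Finset.mul_sum, h'.he] at h1
    linear_combination h1
  have hv3 : ∀ j, v j = z * v' j := by
    intro j
    have := congrArg (starRingEnd ℂ) (hv2 j)
    simp only [map_mul, Complex.conj_conj] at this
    linear_combination - v j * hzz - z * this
  refine ⟨z, fun h0 => by simp [h0] at hzz, ?_⟩
  rintro ⟨j, k⟩
  rw [h.hφ, h'.hφ, hz, huu, hv3]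
  ring

lemma spec_data {N : Type*} [Fintype N] [DecidableEq N] {A : Matrix N N ℂ} (hA : A.IsHermitian) :
    ∃ v : N → N → ℂ, (∀ i, ∑ p, Complex.normSq (v i p) = 1) ∧
      (∀ i j, i ≠ j → ∑ p, v i p * (starRingEnd ℂ) (v j p) = 0) ∧
      (∀ i, A *ᵥ v i = (hA.eigenvalues i : ℂ) • v i) ∧
      A = ∑ i, (hA.eigenvalues i : ℂ) • vecMulVec (v i) (star (v i)) := by
  set U : Matrix N N ℂ := (hA.eigenvectorUnitary : Matrix N N ℂ) with hU
  have hUU : Uᴴ * U = 1 := by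
    rw [← star_eq_conjTranspose]
    exact (Matrix.mem_unitaryGroup_iff'.1 hA.eigenvectorUnitary.2)
  have hent : ∀ i j, ∑ p, U p i * (starRingEnd ℂ) (U p j) = if j = i then 1 else 0 := by
    intro i j
    have := congrFun (congrFun hUU j) i
    rw [mul_apply, one_apply] at this
    rw [← this]
    refine Finset.sum_congr rfl fun p _ => ?_
    rw [conjTranspose_apply, mul_comm]; rfl
  refine ⟨fun i p => U p i, ?_, ?_, ?_, ?_⟩
  · intro i
    apply Complex.ofReal_injective
    push_cast
    simp only [← Complex.mul_conj]
    simpa using hent i i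
  · intro i j hij
    simpa [Ne.symm hij] using hent i j
  · intro i
    have h1 := hA.mulVec_eigenvectorBasis i
    have h2 : (fun p => U p i) = ⇑(hA.eigenvectorBasis i) := by
      funext p; exact hA.eigenvectorUnitary_apply p i
    change A *ᵥ (fun p => U p i) = (hA.eigenvalues i : ℂ) • (fun p => U p i)
    rw [h2, h1]; rfl
  · have h := hA.spectral_theorem
    rw [Unitary.conjStarAlgAut_apply] at h
    conv_lhs => rw [h]
    ext p q
    rw [mul_apply]
    simp only [mul_diagonal, Matrix.sum_apply, Matrix.smul_apply, vecMulVec_apply, Pi.star_apply]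
    refine Finset.sum_congr rfl fun i _ => ?_
    change U p i * (hA.eigenvalues i : ℂ) * star (U q i)
      = (hA.eigenvalues i : ℂ) * (U p i * star (U q i))
    ring

lemma ptrans_add {m n : ℕ} (A B : Matrix (Fin m × Fin n) (Fin m × Fin n) ℂ) :
    ptrans (A + B) = ptrans A + ptrans B := rfl

lemma ptrans_smul {m n : ℕ} (c : ℂ) (A : Matrix (Fin m × Fin n) (Fin m × Fin n) ℂ) :
    ptrans (c • A) = c • ptrans A := rfl

lemma ptrans_sum {m n : ℕ} {ι : Type*} [Fintype ι]
    (A : ι → Matrix (Fin m × Fin n) (Fin m × Fin n) ℂ) :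
    ptrans (∑ i, A i) = ∑ i, ptrans (A i) := by
  ext p q
  simp [ptrans, Matrix.sum_apply]

lemma trace_ptrans {m n : ℕ} (A : Matrix (Fin m × Fin n) (Fin m × Fin n) ℂ) :
    (ptrans A).trace = A.trace := rfl

lemma unit_dot {N : Type*} [Fintype N] {v : N → ℂ} (h : ∑ p, Complex.normSq (v p) = 1) :
    star v ⬝ᵥ v = 1 := by
  simp only [dotProduct, Pi.star_apply, Complex.star_def]
  have : (∑ p, (Complex.normSq (v p) : ℂ)) = 1 := by exact_mod_cast h
  rw [← this]
  refine Finset.sum_congr rfl fun p _ => ?_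
  rw [← Complex.mul_conj, mul_comm]

/-- Forward direction. -/
lemma forward {m n : ℕ} {P Q : Matrix (Fin m × Fin n) (Fin m × Fin n) ℂ}
    (hP : P.PosSemidef) (hQ : Q.PosSemidef) (htr : (P + ptrans Q).trace = 1)
    (ψ : Fin m × Fin n → ℂ) (hψ : ∑ p, Complex.normSq (ψ p) = 1)
    (hW : (P + ptrans Q) *ᵥ ψ = (-(1/2) : ℂ) • ψ) :
    ∃ φ e f u v, ExtPair φ ψ e f u v ∧ P + ptrans Q = ptrans (vecMulVec φ (star φ)) := by
  obtain ⟨f, hf⟩ := struct_ext ψ hψ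
  obtain ⟨w, hw1, hw2, -, hw4⟩ := spec_data hQ.1
  set lam := hQ.1.eigenvalues with hlam
  have hl0 : ∀ i, 0 ≤ lam i := hQ.eigenvalues_nonneg
  have hPq : 0 ≤ (star ψ ⬝ᵥ P *ᵥ ψ).re := by
    have := hQ.1
    exact (Complex.nonneg_iff.1 (hP.dotProduct_mulVec_nonneg ψ)).1
  have hPt : 0 ≤ P.trace.re := (Complex.nonneg_iff.1 hP.trace_nonneg).1
  have hPti : 0 = P.trace.im := (Complex.nonneg_iff.1 hP.trace_nonneg).2
  have hQt : Q.trace.re = ∑ i, lam i := by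
    rw [hQ.1.trace_eq_sum_eigenvalues]; simp [hlam]
  have htr' : P.trace.re + ∑ i, lam i = 1 := by
    rw [trace_add, trace_ptrans] at htr
    have := congrArg Complex.re htr
    rw [Complex.add_re, hQt] at this
    simpa using this
  have hQf : (star ψ ⬝ᵥ ptrans Q *ᵥ ψ).re = ∑ i, lam i * Fr (w i) ψ := by
    conv_lhs => rw [hw4]
    rw [ptrans_sum, Matrix.sum_mulVec, dotProduct_sum, Complex.re_sum]
    refine Finset.sum_congr rfl fun i _ => ?_
    rw [ptrans_smul, Matrix.smul_mulVec, dotProduct_smul, ← form_eq, smul_eq_mul,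
      Complex.re_ofReal_mul]
  have hWf : (star ψ ⬝ᵥ P *ᵥ ψ).re + ∑ i, lam i * Fr (w i) ψ = -(1/2) := by
    rw [← hQf, ← Complex.add_re, ← dotProduct_add, ← add_mulVec, hW, dotProduct_smul, unit_dot hψ]
    norm_num
  have hterm : ∀ i, 0 ≤ lam i * (Fr (w i) ψ + 1/2) := fun i =>
    mul_nonneg (hl0 i) (by linarith [(core_s11 (w i) ψ (hw1 i) hψ).1])
  have hsum : ∑ i, lam i * (Fr (w i) ψ + 1/2)
      = ∑ i, lam i * Fr (w i) ψ + (1/2) * ∑ i, lam i := by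
    rw [Finset.mul_sum, ← Finset.sum_add_distrib]
    exact Finset.sum_congr rfl fun i _ => by ring
  have hs0 : 0 ≤ ∑ i, lam i * (Fr (w i) ψ + 1/2) := Finset.sum_nonneg fun i _ => hterm i
  have hPt0 : P.trace.re = 0 := by linarith
  have hP0 : P = 0 := hP.trace_eq_zero_iff.1 (Complex.ext hPt0 hPti.symm)
  have hl1 : ∑ i, lam i = 1 := by linarith
  have hs1 : ∑ i, lam i * (Fr (w i) ψ + 1/2) = 0 := by linarith
  have hz := (Finset.sum_eq_zero_iff_of_nonneg (fun i _ => hterm i)).1 hs1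
  have hext : ∀ i, lam i ≠ 0 → ∃ e u v, ExtPair (w i) ψ e f u v := by
    intro i hi
    apply hf (w i) (hw1 i)
    have := (mul_eq_zero.1 (hz i (Finset.mem_univ _))).resolve_left hi
    linarith
  obtain ⟨i0, hi0⟩ : ∃ i, lam i ≠ 0 := by
    by_contra! h
    simp [h] at hl1
  obtain ⟨e, u, v, hE⟩ := hext i0 hi0
  have hother : ∀ i, i ≠ i0 → lam i = 0 := by
    intro i hi
    by_contra hne
    obtain ⟨e', u', v', hE'⟩ := hext i hne
    obtain ⟨z, hz0, hz⟩ := ext_unique hE' hE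
    have h1 := hw2 i i0 hi
    have h2 : ∑ p, w i0 p * (starRingEnd ℂ) (w i0 p) = 1 := by
      simp only [Complex.mul_conj]
      exact_mod_cast hw1 i0
    simp only [hz, mul_assoc, ← Finset.mul_sum, h2, mul_one] at h1
    exact hz0 h1
  have hli0 : lam i0 = 1 := by
    rw [← hl1]
    exact (Finset.sum_eq_single i0 (fun i _ hi => hother i hi) (by simp)).symm
  refine ⟨w i0, e, f, u, v, hE, ?_⟩
  rw [hP0, zero_add, hw4, Finset.sum_eq_single i0 (fun i _ hi => by simp [hother i hi]) (by simp),
    hli0]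
  simp

lemma sqrt_two_fact : ((((Real.sqrt 2)⁻¹ : ℝ) : ℂ)) * (((Real.sqrt 2)⁻¹ : ℝ) : ℂ) = 1/2 := by
  rw [← Complex.ofReal_mul, ← mul_inv, Real.mul_self_sqrt (by norm_num)]
  norm_num

lemma sqrt_two_fact' : (((Real.sqrt 2 : ℝ) : ℂ)) * ((Real.sqrt 2 : ℝ) : ℂ) = 2 := by
  rw [← Complex.ofReal_mul, Real.mul_self_sqrt (by norm_num)]
  norm_num

lemma normSq_of_dot {N : Type*} [Fintype N] {v : N → ℂ} (h : star v ⬝ᵥ v = 1) :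
    ∑ p, Complex.normSq (v p) = 1 := by
  apply Complex.ofReal_injective
  push_cast
  rw [← h]
  simp only [dotProduct, Pi.star_apply, Complex.star_def]
  refine Finset.sum_congr rfl fun p _ => ?_
  rw [← Complex.mul_conj, mul_comm]

lemma dot_prodVec {m n : ℕ} (a b : Fin m → ℂ) (c d : Fin n → ℂ) :
    star (prodVec a c) ⬝ᵥ prodVec b d = (star a ⬝ᵥ b) * (star c ⬝ᵥ d) := by
  simp only [dotProduct, prodVec, Fintype.sum_prod_type, Finset.sum_mul_sum, Pi.star_apply,
    star_mul']
  refine Finset.sum_congr rfl fun p _ => Finset.sum_congr rfl fun q _ => by ring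

lemma dot_swap {N : Type*} [Fintype N] {v w : N → ℂ} (h : star v ⬝ᵥ w = 0) :
    star w ⬝ᵥ v = 0 := by
  rw [star_dotProduct, h, star_zero]

lemma backward {m n : ℕ} {b₁ b₂ : Fin m → ℂ} {c₁ c₂ : Fin n → ℂ}
    (hb1 : star b₁ ⬝ᵥ b₁ = 1) (hb2 : star b₂ ⬝ᵥ b₂ = 1) (hb : star b₁ ⬝ᵥ b₂ = 0)
    (hc1 : star c₁ ⬝ᵥ c₁ = 1) (hc2 : star c₂ ⬝ᵥ c₂ = 1) (hc : star c₁ ⬝ᵥ c₂ = 0)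
    (φ : Fin m × Fin n → ℂ)
    (hφ : φ = (((Real.sqrt 2)⁻¹ : ℝ) : ℂ) • (prodVec b₁ c₁ + prodVec b₂ c₂))
    (hH : (ptrans (vecMulVec φ (star φ))).IsHermitian) :
    (⨅ i, hH.eigenvalues i) = -(1/2) := by
  have hb' := dot_swap hb
  have hc' := dot_swap hc
  have hφ1 : ∑ p, Complex.normSq (φ p) = 1 := by
    apply normSq_of_dot
    rw [hφ, star_smul, smul_dotProduct, dotProduct_smul, star_add, add_dotProduct,
      dotProduct_add, dotProduct_add]
    simp only [dot_prodVec, hb1, hb2, hb, hb', hc1, hc2, hc, hc', smul_eq_mul, Complex.star_def,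
      Complex.conj_ofReal]
    linear_combination 2 * sqrt_two_fact
  obtain ⟨w, hw1, -, hw3, -⟩ := spec_data hH
  have hlow : ∀ i, -(1/2) ≤ hH.eigenvalues i := by
    intro i
    have h1 := (core_s11 φ (w i) hφ1 (hw1 i)).1
    rw [← form_eq, hw3, dotProduct_smul, unit_dot (hw1 i)] at h1
    simpa using h1
  set ψ : Fin m × Fin n → ℂ := prodVec (star b₁) c₂ - prodVec (star b₂) c₁ with hψ
  have hψ0 : ψ ≠ 0 := by
    intro h0
    have h1 : star (prodVec (star b₁) c₂) ⬝ᵥ ψ = 0 := by rw [h0, dotProduct_zero]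
    rw [hψ, dotProduct_sub, dot_prodVec, dot_prodVec, hc2, hc', star_star, dotProduct_comm, hb1]
      at h1
    simp at h1
  have hev : ptrans (vecMulVec φ (star φ)) *ᵥ ψ = (-(1/2) : ℂ) • ψ := by
    simp only [dotProduct, Pi.star_apply, Complex.star_def] at hb1 hb2 hb hb' hc1 hc2 hc hc'
    have hC : ∀ k l, ∑ j, (b₁ j * c₁ k + b₂ j * c₂ k) *
        ((starRingEnd ℂ) (b₁ j) * c₂ l - (starRingEnd ℂ) (b₂ j) * c₁ l)
        = c₁ k * c₂ l - c₂ k * c₁ l := by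
      intro k l
      have : ∀ j, (b₁ j * c₁ k + b₂ j * c₂ k) *
        ((starRingEnd ℂ) (b₁ j) * c₂ l - (starRingEnd ℂ) (b₂ j) * c₁ l)
        = (starRingEnd ℂ) (b₁ j) * b₁ j * (c₁ k * c₂ l) + (starRingEnd ℂ) (b₁ j) * b₂ j * (c₂ k * c₂ l)
          - (starRingEnd ℂ) (b₂ j) * b₁ j * (c₁ k * c₁ l)
          - (starRingEnd ℂ) (b₂ j) * b₂ j * (c₂ k * c₁ l) := by
        intro j; ring
      simp only [this, Finset.sum_sub_distrib, Finset.sum_add_distrib, ← Finset.sum_mul, hb1, hb2,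
        hb, hb']
      ring
    have hC2 : ∀ i k, ∑ l, ((starRingEnd ℂ) (b₁ i) * (starRingEnd ℂ) (c₁ l)
          + (starRingEnd ℂ) (b₂ i) * (starRingEnd ℂ) (c₂ l)) * (c₁ k * c₂ l - c₂ k * c₁ l)
        = (starRingEnd ℂ) (b₂ i) * c₁ k - (starRingEnd ℂ) (b₁ i) * c₂ k := by
      intro i k
      have : ∀ l, ((starRingEnd ℂ) (b₁ i) * (starRingEnd ℂ) (c₁ l)
          + (starRingEnd ℂ) (b₂ i) * (starRingEnd ℂ) (c₂ l)) * (c₁ k * c₂ l - c₂ k * c₁ l)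
        = (starRingEnd ℂ) (c₁ l) * c₂ l * ((starRingEnd ℂ) (b₁ i) * c₁ k)
        - (starRingEnd ℂ) (c₁ l) * c₁ l * ((starRingEnd ℂ) (b₁ i) * c₂ k)
        + (starRingEnd ℂ) (c₂ l) * c₂ l * ((starRingEnd ℂ) (b₂ i) * c₁ k)
        - (starRingEnd ℂ) (c₂ l) * c₁ l * ((starRingEnd ℂ) (b₂ i) * c₂ k) := by
        intro l; ring
      simp only [this, Finset.sum_sub_distrib, Finset.sum_add_distrib, ← Finset.sum_mul, hc1, hc2,
        hc, hc']
      ring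
    funext p
    obtain ⟨i, k⟩ := p
    have h3 : (ptrans (vecMulVec φ (star φ)) *ᵥ ψ) (i, k) =
        1/2 * ∑ l, ((starRingEnd ℂ) (b₁ i) * (starRingEnd ℂ) (c₁ l)
          + (starRingEnd ℂ) (b₂ i) * (starRingEnd ℂ) (c₂ l)) *
          ∑ j, (b₁ j * c₁ k + b₂ j * c₂ k) *
        ((starRingEnd ℂ) (b₁ j) * c₂ l - (starRingEnd ℂ) (b₂ j) * c₁ l) := by
      rw [mulVec, dotProduct, Fintype.sum_prod_type, Finset.sum_comm, Finset.mul_sum]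
      refine Finset.sum_congr rfl fun l _ => ?_
      rw [Finset.mul_sum, Finset.mul_sum]
      refine Finset.sum_congr rfl fun j _ => ?_
      rw [← sqrt_two_fact]
      simp only [ptrans, vecMulVec_apply, hφ, hψ, prodVec, Pi.star_apply, Pi.smul_apply,
        Pi.add_apply, Pi.sub_apply, smul_eq_mul, Complex.star_def, map_mul, map_add,
        Complex.conj_ofReal]
      ring
    rw [h3]
    simp only [hC, hC2]
    simp only [hψ, prodVec, Pi.smul_apply, Pi.sub_apply, smul_eq_mul, Pi.star_apply,
      Complex.star_def]
    ring
  have hmem : (-(1/2) : ℝ) ∈ spectrum ℝ (ptrans (vecMulVec φ (star φ))) := by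
    rw [← spectrum.algebraMap_mem_iff ℂ, ← Matrix.spectrum_toLin']
    apply Module.End.HasEigenvalue.mem_spectrum
    apply Module.End.hasEigenvalue_of_hasEigenvector (x := ψ)
    refine ⟨?_, hψ0⟩
    rw [Module.End.mem_eigenspace_iff, toLin'_apply, hev]
    congr 1
    simp
  rw [hH.spectrum_real_eq_range_eigenvalues] at hmem
  obtain ⟨i, hi⟩ := hmem
  haveI : Nonempty (Fin m × Fin n) := ⟨i⟩
  apply le_antisymm
  · rw [← hi]; exact ciInf_le (Set.finite_range _).bddBelow i
  · exact le_ciInf hlow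

/-- For a normalized `m × n` decomposable entanglement witness, the smallest
eigenvalue equals `-1/2` iff `W` is the partial transpose of a pure state whose
two nonzero Schmidt coefficients are both `√2/2`. -/
theorem stmt_11 {m n : ℕ} (hm : 2 ≤ m) (hn : 2 ≤ n)
    (W : Matrix (Fin m × Fin n) (Fin m × Fin n) ℂ)
    (hBP : BlockPositive W) (hNP : ¬ W.PosSemidef) (htr : W.trace = 1)
    (hD : Decomposable W) :
    (⨅ i, hBP.1.eigenvalues i) = -(1 / 2) ↔
      ∃ (b₁ b₂ : Fin m → ℂ) (c₁ c₂ : Fin n → ℂ),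
        star b₁ ⬝ᵥ b₁ = 1 ∧ star b₂ ⬝ᵥ b₂ = 1 ∧ star b₁ ⬝ᵥ b₂ = 0 ∧
        star c₁ ⬝ᵥ c₁ = 1 ∧ star c₂ ⬝ᵥ c₂ = 1 ∧ star c₁ ⬝ᵥ c₂ = 0 ∧
        W = ptrans (Matrix.vecMulVec
          ((((Real.sqrt 2)⁻¹ : ℝ) : ℂ) • (prodVec b₁ c₁ + prodVec b₂ c₂))
          (star ((((Real.sqrt 2)⁻¹ : ℝ) : ℂ) • (prodVec b₁ c₁ + prodVec b₂ c₂)))) := by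
  constructor
  · intro h
    haveI : Nonempty (Fin m × Fin n) := ⟨(⟨0, by omega⟩, ⟨0, by omega⟩)⟩
    obtain ⟨i, hi⟩ := exists_eq_ciInf_of_finite (f := hBP.1.eigenvalues)
    rw [h] at hi
    obtain ⟨w, hw1, -, hw3, -⟩ := spec_data hBP.1
    have hw := hw3 i
    rw [hi] at hw
    obtain ⟨P, Q, hP, hQ, hPQ⟩ := hD
    obtain ⟨φ, e, f, u, v, hE, hWφ⟩ := forward hP hQ (hPQ ▸ htr) (w i) (hw1 i) (by
      rw [← hPQ, hw]; congr 1; simp)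
    have hs : (Real.sqrt 2 : ℂ) ≠ 0 := by
      intro h0
      have := sqrt_two_fact'
      rw [h0] at this
      norm_num at this
    have hdot : ∀ {q : ℕ} (x y : Fin q → ℂ), star x ⬝ᵥ y = ∑ k, y k * (starRingEnd ℂ) (x k) := by
      intro q x y
      simp only [dotProduct, Pi.star_apply, Complex.star_def]
      exact Finset.sum_congr rfl fun _ _ => mul_comm _ _
    have hsc : ∀ x y : Fin m → ℂ, star ((Real.sqrt 2 : ℂ) • x) ⬝ᵥ ((Real.sqrt 2 : ℂ) • y)
        = 2 * ∑ k, y k * (starRingEnd ℂ) (x k) := by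
      intro x y
      rw [star_smul, smul_dotProduct, dotProduct_smul, hdot, Complex.star_def,
        Complex.conj_ofReal, smul_eq_mul, smul_eq_mul, ← mul_assoc, sqrt_two_fact']
    refine ⟨(Real.sqrt 2 : ℂ) • u, (Real.sqrt 2 : ℂ) • v, e, f, ?_, ?_, ?_, ?_, ?_, ?_, ?_⟩
    · rw [hsc, hE.hu]; norm_num
    · rw [hsc, hE.hv]; norm_num
    · apply dot_swap
      rw [hsc, hE.huv]; norm_num
    · rw [hdot, hE.he]
    · rw [hdot, hE.hf]
    · apply dot_swap
      rw [hdot, hE.hef]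
    · have hφ : φ = (((Real.sqrt 2)⁻¹ : ℝ) : ℂ) •
          (prodVec ((Real.sqrt 2 : ℂ) • u) e + prodVec ((Real.sqrt 2 : ℂ) • v) f) := by
        funext ⟨j, k⟩
        simp only [prodVec, Pi.smul_apply, Pi.add_apply, smul_eq_mul]
        rw [hE.hφ, Complex.ofReal_inv]
        field_simp
      rw [← hφ, hPQ, hWφ]
  · rintro ⟨b₁, b₂, c₁, c₂, hb1, hb2, hb, hc1, hc2, hc, hW⟩
    subst hW
    exact backward hb1 hb2 hb hc1 hc2 hc _ rfl hBP.1

end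
end
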